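/- arXiv:1904.03104 — 11 statements merged into one kernel-verified Lean document; each statement's English description precedes it below -/
import Mathlib

section
/- Let C be a rank distance code in the space of m×n matrices over the finite field F_q with at least two elements, and let d be its minimum distance. Then |C| ≤ q^{max(m,n)·(min(m,n)−d+1)}. -/
open Matrix
section MatrixCodeDefs

variable (Fq : Type*) [Field Fq] [Fintype Fq]

/-- The set of values of the rank distance between distinct elements of `C`. -/
def rankDistSet (m n : ℕ) (C : Set (Matrix (Fin m) (Fin n) Fq)) : Set ℕ :=
  {r : ℕ | ∃ A ∈ C, ∃ B ∈ C, A ≠ B ∧ (A - B).rank = r}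

/-- `C` is a rank distance code with minimum distance `d` which attains the
Singleton-like bound, i.e. a maximum rank distance (MRD) code. -/
def IsMRD (m n : ℕ) (C : Set (Matrix (Fin m) (Fin n) Fq)) (d : ℕ) : Prop :=
  IsLeast (rankDistSet Fq m n C) d ∧
  Nat.card C = Fintype.card Fq ^ (max m n * (min m n - d + 1))

/-- The Delsarte dual of an `Fq`-linear rank distance code, with respect to the
bilinear form `⟨M, N⟩ = Tr(M Nᵀ)`. -/
def delsarteDual (m n : ℕ) (C : Submodule Fq (Matrix (Fin m) (Fin n) Fq)) :
    Submodule Fq (Matrix (Fin m) (Fin n) Fq) where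
  carrier := {N | ∀ M ∈ C, (M * Nᵀ).trace = 0}
  add_mem' := by
    intro a b ha hb M hM
    simp [Matrix.transpose_add, Matrix.mul_add, ha M hM, hb M hM]
  zero_mem' := by
    intro M hM
    simp
  smul_mem' := by
    intro c a ha M hM
    simp [Matrix.transpose_smul, Matrix.mul_smul, ha M hM]

/-- Equivalence of rank distance codes: `C' = {X A^σ Y : A ∈ C}` with `X, Y` invertible
and `σ` a field automorphism applied entrywise. -/
def MatCodeEquiv (m n : ℕ) (C C' : Set (Matrix (Fin m) (Fin n) Fq)) : Prop :=
  ∃ (X : Matrix (Fin m) (Fin m) Fq) (Y : Matrix (Fin n) (Fin n) Fq) (σ : Fq ≃+* Fq),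
    IsUnit X ∧ IsUnit Y ∧ C' = (fun A => X * A.map σ * Y) '' C

/-- The left idealiser of a rank distance code. -/
def leftIdl (m n : ℕ) (C : Set (Matrix (Fin m) (Fin n) Fq)) :
    Set (Matrix (Fin m) (Fin m) Fq) :=
  {Y | ∀ A ∈ C, Y * A ∈ C}

/-- The right idealiser of a rank distance code. -/
def rightIdl (m n : ℕ) (C : Set (Matrix (Fin m) (Fin n) Fq)) :
    Set (Matrix (Fin n) (Fin n) Fq) :=
  {Z | ∀ A ∈ C, A * Z ∈ C}

/-- `S` is a (finite) field under matrix addition and multiplication. -/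
def IsFieldOfMatrices (l : ℕ) (S : Set (Matrix (Fin l) (Fin l) Fq)) : Prop :=
  (0 : Matrix (Fin l) (Fin l) Fq) ∈ S ∧ (1 : Matrix (Fin l) (Fin l) Fq) ∈ S ∧
  (∀ a ∈ S, ∀ b ∈ S, a + b ∈ S) ∧
  (∀ a ∈ S, -a ∈ S) ∧
  (∀ a ∈ S, ∀ b ∈ S, a * b ∈ S) ∧
  (∀ a ∈ S, ∀ b ∈ S, a * b = b * a) ∧
  (∀ a ∈ S, a ≠ 0 → ∃ b ∈ S, a * b = 1)

end MatrixCodeDefs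

theorem singleton_aux (Fq : Type*) [Field Fq] [Fintype Fq] (a b d : ℕ)
    (C : Set (Matrix (Fin a) (Fin b) Fq)) (hd0 : 1 ≤ d) (hda : d ≤ a)
    (h : ∀ A ∈ C, ∀ B ∈ C, A ≠ B → d ≤ (A - B).rank) :
    Nat.card C ≤ Fintype.card Fq ^ (b * (a - d + 1)) := by
  classical
  have hk : a - d + 1 ≤ a := by omega
  let f : C → (Fin (a - d + 1) → Fin b → Fq) := fun A i j => A.1 (Fin.castLE hk i) j
  have hf : Function.Injective f := by
    rintro ⟨A, hA⟩ ⟨B, hB⟩ hAB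
    by_contra hne
    have hne' : A ≠ B := fun e => hne (Subtype.ext e)
    have h1 := h A hA B hB hne'
    have hz : ∀ i : Fin a, (i : ℕ) < a - d + 1 → ∀ j, (A - B) i j = 0 := by
      intro i hi j
      have := congrFun (congrFun hAB ⟨i, hi⟩) j
      simp only [f] at this
      rw [Matrix.sub_apply, sub_eq_zero]
      exact this
    let S : Finset (Fin a) := Finset.univ.filter fun i => ¬ (i : ℕ) < a - d + 1
    have h2 : (A - B).rank ≤ S.card := by
      apply Matrix.rank_le_card_of_support_subset
      rw [Function.support_subset_iff']
      intro i hi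
      have hi' : (i : ℕ) < a - d + 1 := by
        by_contra hc
        exact hi (Finset.mem_coe.2 (Finset.mem_filter.2 ⟨Finset.mem_univ _, hc⟩))
      funext j
      exact hz i hi' j
    have h3 : S.card ≤ a - (a - d + 1) := by
      rw [← Nat.card_Ico, ← Finset.card_map Fin.valEmbedding]
      apply Finset.card_le_card
      intro x hx
      obtain ⟨i, hi, rfl⟩ := Finset.mem_map.1 hx
      have := (Finset.mem_filter.1 hi).2
      exact Finset.mem_Ico.2 ⟨not_lt.1 this, i.2⟩
    omega
  have := Nat.card_le_card_of_injective f hf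
  refine this.trans (le_of_eq ?_)
  simp [Nat.card_eq_fintype_card, pow_mul]

/-- Singleton-like bound, Delsarte: if `C ⊆ F_q^{m×n}` is a rank
distance code with minimum distance `d`, then `|C| ≤ q^(max(m,n)·(min(m,n)−d+1))`. -/
theorem singleton_bound (Fq : Type*) [Field Fq] [Fintype Fq] (m n : ℕ)
    (C : Set (Matrix (Fin m) (Fin n) Fq)) (d : ℕ)
    (hd : IsLeast (rankDistSet Fq m n C) d) :
    Nat.card C ≤ Fintype.card Fq ^ (max m n * (min m n - d + 1)) := by
  obtain ⟨⟨A, hA, B, hB, hne, hr⟩, hmin⟩ := hd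
  have hd0 : 1 ≤ d := by
    rw [Nat.one_le_iff_ne_zero]
    intro h0
    apply hne
    rw [← sub_eq_zero]
    rw [← hr, Matrix.rank, Submodule.finrank_eq_zero, LinearMap.range_eq_bot] at h0
    ext i j
    have := congrFun (LinearMap.congr_fun h0 (Pi.single j 1)) i
    simpa using this
  have hdm : d ≤ m := hr ▸ Matrix.rank_le_height _
  have hdn : d ≤ n := hr ▸ Matrix.rank_le_width _
  rcases le_total m n with hmn | hmn
  · rw [max_eq_right hmn, min_eq_left hmn]
    exact singleton_aux Fq m n d C hd0 hdm fun A hA B hB hne => hmin ⟨A, hA, B, hB, hne, rfl⟩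
  · rw [max_eq_left hmn, min_eq_right hmn]
    have := singleton_aux Fq n m d (Matrix.transpose '' C) hd0 hdn (by
      rintro _ ⟨A, hA, rfl⟩ _ ⟨B, hB, rfl⟩ hne
      rw [← Matrix.transpose_sub, Matrix.rank_transpose]
      exact hmin ⟨A, hA, B, hB, fun e => hne (by rw [e]), rfl⟩)
    rwa [Nat.card_image_of_injective Matrix.transpose_injective] at this
end

section
/- Let C ⊆ F_q^{m×n} be an F_q-linear MRD code of dimension k over F_q whose minimum distance d satisfies d > 1. Then the Delsarte dual code C^⊥ is an MRD code of dimension mn − k over F_q. -/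
open Matrix
theorem aux_K {F : Type*} [Field F] {m n : ℕ} (N : Matrix (Fin m) (Fin n) F) (t : ℕ)
    (ht : t + N.rank ≤ m) :
    ∃ K : Submodule F (Matrix (Fin m) (Fin n) F), Module.finrank F K = t * n ∧
      ∀ M ∈ K, M.rank ≤ t ∧ (M * Nᵀ).trace = 0 := by
  have h1 := LinearMap.finrank_range_add_finrank_ker (Nᵀ).mulVecLin
  have h2 : Module.finrank F (LinearMap.range (Nᵀ).mulVecLin) = N.rank := by
    rw [← Matrix.rank_transpose]; rfl
  rw [h2, Module.finrank_fin_fun] at h1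
  obtain ⟨f, hf⟩ := exists_linearIndependent_of_le_finrank
    (show t ≤ Module.finrank F (LinearMap.ker (Nᵀ).mulVecLin) by omega)
  have hf' : LinearIndependent F (fun i => (f i : Fin m → F)) :=
    hf.map' (Submodule.subtype _) (Submodule.ker_subtype _)
  let P : Matrix (Fin m) (Fin t) F := Matrix.of fun i j => (f j : Fin m → F) i
  have hP : Function.Injective P.mulVec := by
    rw [Matrix.mulVec_injective_iff]
    exact hf'
  have hNP : Nᵀ * P = 0 := by
    ext i j
    have := (f j).2
    rw [LinearMap.mem_ker] at this
    exact congrFun this i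
  let φ : Matrix (Fin t) (Fin n) F →ₗ[F] Matrix (Fin m) (Fin n) F :=
    { toFun := fun X => P * X
      map_add' := fun X Y => Matrix.mul_add _ _ _
      map_smul' := fun c X => by simp }
  have hφ : Function.Injective φ := by
    intro X Y h
    ext i j
    have : (fun i => X i j) = (fun i => Y i j) := by
      apply hP
      funext a
      exact congrFun (congrFun h a) j
    exact congrFun this i
  refine ⟨LinearMap.range φ, ?_, ?_⟩
  · rw [LinearMap.finrank_range_of_inj hφ, Module.finrank_matrix]
    simp
  · rintro _ ⟨X, rfl⟩
    constructor
    · exact (Matrix.rank_mul_le_left P X).trans (by simpa using Matrix.rank_le_width P)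
    · change (P * X * Nᵀ).trace = 0
      rw [Matrix.trace_mul_comm, ← Matrix.mul_assoc, hNP]
      simp

theorem aux_nondeg {F : Type*} [Field F] {m n : ℕ} (N : Matrix (Fin m) (Fin n) F)
    (h : ∀ M : Matrix (Fin m) (Fin n) F, (M * Nᵀ).trace = 0) : N = 0 := by
  ext i j
  have := h (Matrix.single i j 1)
  simpa [Matrix.trace_single_mul] using this

theorem aux_one {F : Type*} [Field F] {m n d : ℕ} (C : Submodule F (Matrix (Fin m) (Fin n) F))
    (hd : 1 < d) (hdm : d ≤ m) (hC : ∀ M ∈ C, M ≠ 0 → d ≤ M.rank)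
    (hdim : Module.finrank F C = n * (m - d + 1)) (N : Matrix (Fin m) (Fin n) F)
    (hN : ∀ M ∈ C, (M * Nᵀ).trace = 0) (h0 : N ≠ 0) : m - d + 2 ≤ N.rank := by
  by_contra hlt
  obtain ⟨K, hK, hK2⟩ := aux_K N (d - 1) (by omega)
  have hdis : C ⊓ K = ⊥ := by
    rw [eq_bot_iff]
    intro M hM
    by_contra hM0
    have h1 := hC M hM.1 hM0
    have h2 := (hK2 M hM.2).1
    omega
  have hsum := Submodule.finrank_sup_add_finrank_inf_eq C K
  have htop : C ⊔ K = ⊤ := by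
    apply Submodule.eq_top_of_finrank_eq
    rw [hdis, finrank_bot, hdim, hK] at hsum
    rw [Module.finrank_matrix]
    simp only [Fintype.card_fin, Module.finrank_self, mul_one]
    obtain ⟨a, rfl⟩ := Nat.exists_eq_add_of_le hdm
    obtain ⟨b, rfl⟩ := Nat.exists_eq_add_of_le hd.le
    rw [add_zero] at hsum
    rw [hsum, Nat.add_sub_cancel_left, Nat.add_sub_cancel_left]; ring
  apply h0
  apply aux_nondeg
  intro M
  have hM : M ∈ C ⊔ K := by rw [htop]; trivial
  obtain ⟨x, hx, y, hy, rfl⟩ := Submodule.mem_sup.1 hM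
  rw [Matrix.add_mul, Matrix.trace_add, hN x hx, (hK2 y hy).2, add_zero]

theorem aux_two {F : Type*} [Field F] {m n e : ℕ} (D : Submodule F (Matrix (Fin m) (Fin n) F))
    (he : e ≤ m) (hdim : m * n < Module.finrank F D + e * n) :
    ∃ M ∈ D, M ≠ 0 ∧ M.rank ≤ e := by
  obtain ⟨K, hK, hK2⟩ := aux_K (0 : Matrix (Fin m) (Fin n) F) e (by simpa using he)
  have hsum := Submodule.finrank_sup_add_finrank_inf_eq D K
  have hle := Submodule.finrank_le (D ⊔ K)
  rw [Module.finrank_matrix] at hle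
  simp only [Fintype.card_fin, Module.finrank_self, mul_one] at hle
  have hne : D ⊓ K ≠ ⊥ := by
    intro h
    rw [h, finrank_bot] at hsum
    omega
  obtain ⟨M, hM, hM0⟩ := Submodule.exists_mem_ne_zero_of_ne_bot hne
  exact ⟨M, hM.1, hM0, (hK2 M hM.2).1⟩

theorem aux_dim (F : Type*) [Field F] [Fintype F] (m n : ℕ)
    (C : Submodule F (Matrix (Fin m) (Fin n) F)) :
    Module.finrank F (delsarteDual F m n C) = m * n - Module.finrank F C := by
  let B : LinearMap.BilinForm F (Matrix (Fin m) (Fin n) F) :=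
    LinearMap.mk₂ F (fun M N => (M * Nᵀ).trace)
      (by intros; simp [Matrix.add_mul]) (by intros; simp)
      (by intros; simp [Matrix.mul_add]) (by intros; simp)
  have hsymm : ∀ M N, B M N = B N M := by
    intro M N
    change (M * Nᵀ).trace = (N * Mᵀ).trace
    rw [← Matrix.trace_transpose, Matrix.transpose_mul, Matrix.transpose_transpose]
  have hrefl : B.IsRefl := fun M N h => by rw [hsymm]; exact h
  have hnd : B.Nondegenerate := by
    refine ⟨fun N h => aux_nondeg N fun M => ?_, fun N h => aux_nondeg N h⟩
    have := h M
    rw [hsymm] at this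
    exact this
  have := LinearMap.BilinForm.finrank_orthogonal hnd C
  rw [Module.finrank_matrix] at this
  simp only [Fintype.card_fin, Module.finrank_self, mul_one] at this
  rw [← this]
  rfl

theorem aux_main {F : Type*} [Field F] {m n d : ℕ} (C D : Submodule F (Matrix (Fin m) (Fin n) F))
    (hn : 0 < n) (hd : 1 < d) (hdm : d ≤ m) (hC : ∀ M ∈ C, M ≠ 0 → d ≤ M.rank)
    (hdim : Module.finrank F C = n * (m - d + 1))
    (hD : ∀ N ∈ D, ∀ M ∈ C, (M * Nᵀ).trace = 0)
    (hDdim : Module.finrank F D = m * n - Module.finrank F C) :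
    (∀ N ∈ D, N ≠ 0 → m - d + 2 ≤ N.rank) ∧ (∃ N ∈ D, N ≠ 0 ∧ N.rank = m - d + 2) ∧
    Module.finrank F D = n * (m - (m - d + 2) + 1) := by
  have h1 : ∀ N ∈ D, N ≠ 0 → m - d + 2 ≤ N.rank := fun N hN h0 =>
    aux_one C hd hdm hC hdim N (hD N hN) h0
  have h3 : Module.finrank F D = n * (m - (m - d + 2) + 1) := by
    rw [hDdim, hdim, mul_comm m n, ← Nat.mul_sub]
    congr 1; omega
  refine ⟨h1, ?_, h3⟩
  obtain ⟨M, hM, h0, hr⟩ := aux_two (e := m - d + 2) D (by omega) (by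
    rw [h3, mul_comm _ n, mul_comm _ n, ← Nat.mul_add]
    exact Nat.mul_lt_mul_of_pos_left (by omega) hn)
  exact ⟨M, hM, h0, le_antisymm hr (h1 M hM h0)⟩

/-- Delsarte: the Delsarte dual of an `Fq`-linear MRD code of
dimension `k` with minimum distance `d > 1` is an MRD code of dimension `mn − k`. -/
theorem delsarte_dual_MRD (Fq : Type*) [Field Fq] [Fintype Fq] (m n : ℕ)
    (C : Submodule Fq (Matrix (Fin m) (Fin n) Fq)) (k d : ℕ)
    (hMRD : IsMRD Fq m n (C : Set (Matrix (Fin m) (Fin n) Fq)) d)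
    (hd : 1 < d)
    (hk : Module.finrank Fq C = k) :
    (∃ d' : ℕ, IsMRD Fq m n ((delsarteDual Fq m n C : Submodule Fq (Matrix (Fin m) (Fin n) Fq)) :
        Set (Matrix (Fin m) (Fin n) Fq)) d') ∧
    Module.finrank Fq (delsarteDual Fq m n C) = m * n - k := by
  have hdd := aux_dim Fq m n C
  refine ⟨?_, hk ▸ hdd⟩
  obtain ⟨⟨⟨A, hA, B, hB, hAB, hr⟩, hlow⟩, hcard⟩ := hMRD
  have hC : ∀ M ∈ C, M ≠ 0 → d ≤ M.rank := fun M hM h0 =>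
    hlow ⟨M, hM, 0, C.zero_mem, h0, by simp⟩
  have hdm : d ≤ m := hr ▸ Matrix.rank_le_height _
  have hdn : d ≤ n := hr ▸ Matrix.rank_le_width _
  have hcardS : ∀ S : Submodule Fq (Matrix (Fin m) (Fin n) Fq),
      Nat.card (S : Set (Matrix (Fin m) (Fin n) Fq)) = Fintype.card Fq ^ Module.finrank Fq S := by
    intro S
    have := Module.natCard_eq_pow_finrank (K := Fq) (V := S)
    rw [Nat.card_eq_fintype_card (α := Fq)] at this
    exact this
  have hdim : Module.finrank Fq C = max m n * (min m n - d + 1) := by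
    rw [hcardS] at hcard
    exact Nat.pow_right_injective (Fintype.one_lt_card) hcard
  set D := delsarteDual Fq m n C with hDdef
  have hD : ∀ N ∈ D, ∀ M ∈ C, (M * Nᵀ).trace = 0 := fun N hN => hN
  suffices h : (∀ N ∈ D, N ≠ 0 → min m n - d + 2 ≤ N.rank) ∧
      (∃ N ∈ D, N ≠ 0 ∧ N.rank = min m n - d + 2) ∧
      Module.finrank Fq D = max m n * (min m n - (min m n - d + 2) + 1) by
    obtain ⟨h1, ⟨N, hN, h0, h2⟩, h3⟩ := h
    refine ⟨min m n - d + 2, ⟨⟨N, hN, 0, D.zero_mem, h0, by simpa using h2⟩, ?_⟩, ?_⟩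
    · rintro _ ⟨X, hX, Y, hY, hXY, rfl⟩
      exact h1 _ (D.sub_mem hX hY) (sub_ne_zero.2 hXY)
    · rw [hcardS, h3]
  rcases le_total m n with hmn | hmn
  · rw [min_eq_left hmn, max_eq_right hmn] at *
    exact aux_main C D (by omega) hd hdm hC hdim hD hdd
  · rw [min_eq_right hmn, max_eq_left hmn] at *
    let τ : Matrix (Fin m) (Fin n) Fq ≃ₗ[Fq] Matrix (Fin n) (Fin m) Fq :=
      Matrix.transposeLinearEquiv (Fin m) (Fin n) Fq Fq
    have hfr : ∀ S : Submodule Fq (Matrix (Fin m) (Fin n) Fq),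
        Module.finrank Fq (S.map τ.toLinearMap) = Module.finrank Fq S :=
      fun S => LinearEquiv.finrank_map_eq τ S
    have := aux_main (C.map τ.toLinearMap) (D.map τ.toLinearMap) (n := m) (m := n)
      (by omega) hd hdn
      (by
        rintro _ ⟨M, hM, rfl⟩ h0
        change d ≤ Mᵀ.rank
        rw [Matrix.rank_transpose]
        exact hC M hM (by rintro rfl; exact h0 (map_zero _)))
      (by rw [hfr]; exact hdim)
      (by
        rintro _ ⟨N, hN, rfl⟩ _ ⟨M, hM, rfl⟩
        change (Mᵀ * Nᵀᵀ).trace = 0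
        rw [Matrix.transpose_transpose, Matrix.trace_mul_comm, ← Matrix.trace_transpose,
          Matrix.transpose_mul, Matrix.transpose_transpose]
        exact hD N hN M hM)
      (by rw [hfr, hfr, hdd, mul_comm])
    obtain ⟨h1, ⟨_, ⟨N, hN, rfl⟩, h0, h2⟩, h3⟩ := this
    refine ⟨?_, ⟨N, hN, ?_, ?_⟩, ?_⟩
    · intro N hN h0
      rw [← Matrix.rank_transpose]
      exact h1 Nᵀ ⟨N, hN, rfl⟩ (by simpa using h0)
    · rintro rfl; exact h0 (map_zero _)
    · rw [← Matrix.rank_transpose]; exact h2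
    · rw [← hfr]; exact h3
end

section
/- If C₁ and C₂ are equivalent F_q-linear rank distance codes in F_q^{m×n}, then their left idealisers L(C₁) and L(C₂) are equivalent as rank distance codes (in F_q^{m×m}), and their right idealisers R(C₁) and R(C₂) are equivalent as rank distance codes (in F_q^{n×n}). -/
open Matrix
/-- equivalent `Fq`-linear rank distance codes have equivalent left
(resp. right) idealisers. -/
theorem idealisers_of_equivalent_codes (Fq : Type*) [Field Fq] [Fintype Fq] (m n : ℕ)
    (C₁ C₂ : Submodule Fq (Matrix (Fin m) (Fin n) Fq))
    (h : MatCodeEquiv Fq m n (C₁ : Set (Matrix (Fin m) (Fin n) Fq))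
      (C₂ : Set (Matrix (Fin m) (Fin n) Fq))) :
    MatCodeEquiv Fq m m (leftIdl Fq m n (C₁ : Set (Matrix (Fin m) (Fin n) Fq)))
      (leftIdl Fq m n (C₂ : Set (Matrix (Fin m) (Fin n) Fq))) ∧
    MatCodeEquiv Fq n n (rightIdl Fq m n (C₁ : Set (Matrix (Fin m) (Fin n) Fq)))
      (rightIdl Fq m n (C₂ : Set (Matrix (Fin m) (Fin n) Fq))) := by
  obtain ⟨X, Y, σ, hX, hY, hC⟩ := h
  obtain ⟨⟨X, X', hX1, hX2⟩, rfl⟩ := hX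
  obtain ⟨⟨Y, Y', hY1, hY2⟩, rfl⟩ := hY
  simp only at hC
  have hmem : ∀ B, B ∈ C₂ ↔ ∃ A ∈ C₁, X * A.map σ * Y = B := by
    intro B
    rw [← SetLike.mem_coe, hC]
    rfl
  have hinj : ∀ A B : Matrix (Fin m) (Fin n) Fq,
      X * A.map σ * Y = X * B.map σ * Y → A = B := by
    intro A B hAB
    have key : ∀ M : Matrix (Fin m) (Fin n) Fq, X' * (X * M * Y) * Y' = M := by
      intro M
      calc X' * (X * M * Y) * Y' = (X' * X) * M * (Y * Y') := by
            simp only [Matrix.mul_assoc]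
        _ = M := by rw [hX2, hY1, Matrix.one_mul, Matrix.mul_one]
    have h2 : A.map σ = B.map σ := by
      rw [← key (A.map σ), hAB, key]
    exact Matrix.map_injective σ.injective h2
  have hback : ∀ (k : ℕ) (Z : Matrix (Fin k) (Fin k) Fq), (Z.map σ.symm).map σ = Z := by
    intro k Z
    ext i j
    simp
  constructor
  · have hL : ∀ (L : Matrix (Fin m) (Fin m) Fq) (A : Matrix (Fin m) (Fin n) Fq),
        (X * L.map σ * X') * (X * A.map σ * Y) = X * (L * A).map σ * Y := by
      intro L A
      rw [Matrix.map_mul]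
      calc (X * L.map σ * X') * (X * A.map σ * Y)
          = X * L.map σ * (X' * X) * A.map σ * Y := by simp only [Matrix.mul_assoc]
        _ = _ := by rw [hX2, Matrix.mul_one]; simp only [Matrix.mul_assoc]
    refine ⟨X, X', σ, ⟨⟨X, X', hX1, hX2⟩, rfl⟩, ⟨⟨X', X, hX2, hX1⟩, rfl⟩, ?_⟩
    ext Z
    constructor
    · intro hZ
      have hφ : X * ((X' * Z * X).map σ.symm).map σ * X' = Z := by
        rw [hback]
        calc X * (X' * Z * X) * X' = (X * X') * Z * (X * X') := by
              simp only [Matrix.mul_assoc]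
          _ = Z := by rw [hX1, Matrix.one_mul, Matrix.mul_one]
      refine ⟨(X' * Z * X).map σ.symm, ?_, hφ⟩
      intro A hA
      have h1 := hZ _ ((hmem _).2 ⟨A, hA, rfl⟩)
      rw [← hφ, hL] at h1
      obtain ⟨A', hA', h2⟩ := (hmem _).1 h1
      rw [← hinj _ _ h2]
      exact hA'
    · rintro ⟨L, hLm, rfl⟩ B hB
      obtain ⟨A, hA, rfl⟩ := (hmem _).1 hB
      exact (hmem _).2 ⟨L * A, hLm A hA, (hL L A).symm⟩
  · have hR : ∀ (L : Matrix (Fin n) (Fin n) Fq) (A : Matrix (Fin m) (Fin n) Fq),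
        (X * A.map σ * Y) * (Y' * L.map σ * Y) = X * (A * L).map σ * Y := by
      intro L A
      rw [Matrix.map_mul]
      calc (X * A.map σ * Y) * (Y' * L.map σ * Y)
          = X * A.map σ * (Y * Y') * L.map σ * Y := by simp only [Matrix.mul_assoc]
        _ = _ := by rw [hY1, Matrix.mul_one]; simp only [Matrix.mul_assoc]
    refine ⟨Y', Y, σ, ⟨⟨Y', Y, hY2, hY1⟩, rfl⟩, ⟨⟨Y, Y', hY1, hY2⟩, rfl⟩, ?_⟩
    ext Z
    constructor
    · intro hZ
      have hφ : Y' * ((Y * Z * Y').map σ.symm).map σ * Y = Z := by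
        rw [hback]
        calc Y' * (Y * Z * Y') * Y = (Y' * Y) * Z * (Y' * Y) := by
              simp only [Matrix.mul_assoc]
          _ = Z := by rw [hY2, Matrix.one_mul, Matrix.mul_one]
      refine ⟨(Y * Z * Y').map σ.symm, ?_, hφ⟩
      intro A hA
      have h1 := hZ _ ((hmem _).2 ⟨A, hA, rfl⟩)
      rw [← hφ, hR] at h1
      obtain ⟨A', hA', h2⟩ := (hmem _).1 h1
      rw [← hinj _ _ h2]
      exact hA'
    · rintro ⟨L, hLm, rfl⟩ B hB
      obtain ⟨A, hA, rfl⟩ := (hmem _).1 hB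
      exact (hmem _).2 ⟨A * L, hLm A hA, (hR L A).symm⟩
end

section
/- Let C be an F_q-linear MRD code in F_q^{m×n} with minimum distance d > 1. If m ≤ n, then the left idealiser L(C) is a finite field with |L(C)| ≤ q^m. If m ≥ n, then the right idealiser R(C) is a finite field with |R(C)| ≤ q^n. In particular, when m = n both L(C) and R(C) are finite fields. -/
open Matrix
theorem aux_singleton {F : Type*} [Field F] {m n d : ℕ} {V : Type*} [AddCommGroup V]
    [Module F V] (g : V →ₗ[F] Matrix (Fin m) (Fin n) F)
    (hg : ∀ v, v ≠ 0 → d ≤ (g v).rank) (hd : 1 ≤ d) (U : Submodule F (Fin m → F))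
    (hU : ∀ v j, (fun i => g v i j) ∈ U) :
    Module.finrank F V ≤ n * (Module.finrank F U - (d - 1)) := by
  obtain ⟨W, hW⟩ : ∃ W : Submodule F U, Module.finrank F W = min (Module.finrank F U) (d - 1) := by
    obtain ⟨w, hw⟩ := exists_linearIndependent_of_le_finrank (R := F) (M := U)
      (n := min (Module.finrank F U) (d - 1)) (min_le_left _ _)
    exact ⟨Submodule.span F (Set.range w), by simpa using finrank_span_eq_card hw⟩
  let col : Fin n → V →ₗ[F] U := fun j =>
    { toFun := fun v => ⟨fun i => g v i j, hU v j⟩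
      map_add' := fun a b => by ext i; simp
      map_smul' := fun a b => by ext i; simp }
  let Φ : V →ₗ[F] (Fin n → U ⧸ W) := LinearMap.pi fun j => W.mkQ ∘ₗ col j
  have hΦ : Function.Injective Φ := by
    rw [← LinearMap.ker_eq_bot, LinearMap.ker_eq_bot']
    intro v hv
    by_contra hne
    have h1 := hg v hne
    have h2 : (g v).rank ≤ Module.finrank F (W.map U.subtype) := by
      rw [Matrix.rank_eq_finrank_span_cols]
      apply Submodule.finrank_mono
      rw [Submodule.span_le]
      rintro _ ⟨j, rfl⟩
      have := congrFun hv j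
      have h3 : col j v ∈ W := by
        rw [← Submodule.Quotient.mk_eq_zero]
        exact this
      exact ⟨col j v, h3, rfl⟩
    have h3 : Module.finrank F (W.map U.subtype) ≤ Module.finrank F W :=
      Submodule.finrank_map_le _ _
    omega
  have h := LinearMap.finrank_le_finrank_of_injective hΦ
  have hfree : Module.Free F (U ⧸ W) := Module.Free.of_divisionRing F (U ⧸ W)
  rw [Module.finrank_pi_fintype] at h
  have hq := Submodule.finrank_quotient_add_finrank W
  simp only [Finset.sum_const, Finset.card_univ, Fintype.card_fin, smul_eq_mul] at h
  refine h.trans (Nat.mul_le_mul_left _ ?_)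
  omega

theorem aux_unit {F : Type*} [Field F] {m n d : ℕ} (C : Submodule F (Matrix (Fin m) (Fin n) F))
    (hC : ∀ A ∈ C, A ≠ 0 → d ≤ A.rank) (hd : 1 < d) (hdm : d ≤ m) (hn : 0 < n)
    (hcard : Module.finrank F C = n * (m - d + 1))
    (Y : Matrix (Fin m) (Fin m) F) (hY : ∀ A ∈ C, Y * A ∈ C) (hY0 : Y ≠ 0) : IsUnit Y := by
  obtain ⟨f, hf⟩ : ∃ f : C →ₗ[F] C, ∀ A, (f A).1 = Y * A.1 :=
   ⟨{ toFun := fun A => ⟨Y * A.1, hY _ A.2⟩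
      map_add' := fun a b => by ext1; simp [Matrix.mul_add]
      map_smul' := fun a b => by ext1; simp }, fun A => rfl⟩
  let g1 : LinearMap.ker f →ₗ[F] Matrix (Fin m) (Fin n) F :=
    C.subtype ∘ₗ (LinearMap.ker f).subtype
  have h1 := aux_singleton (V := LinearMap.ker f) (d := d) g1
    (fun v hv => hC _ v.1.2 (by
      intro h
      exact hv (by ext1; ext1; exact h))) hd.le (LinearMap.ker Y.mulVecLin) (by
      intro v j
      have h := v.2
      rw [LinearMap.mem_ker] at h
      have h : Y * v.1.1 = 0 := (hf _).symm.trans (congrArg Subtype.val h)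
      rw [LinearMap.mem_ker]
      ext i
      exact congrFun (congrFun h i) j)
  let g2 : LinearMap.range f →ₗ[F] Matrix (Fin m) (Fin n) F :=
    C.subtype ∘ₗ (LinearMap.range f).subtype
  have h2 := aux_singleton (V := LinearMap.range f) (d := d) g2
    (fun v hv => hC _ v.1.2 (by
      intro h
      exact hv (by ext1; ext1; exact h))) hd.le (LinearMap.range Y.mulVecLin) (by
      rintro ⟨_, A, rfl⟩ j
      refine ⟨fun i => A.1 i j, ?_⟩
      ext i
      exact (congrFun (congrFun (hf A) i) j).symm)
  have h3 := LinearMap.finrank_range_add_finrank_ker f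
  have h4 := LinearMap.finrank_range_add_finrank_ker Y.mulVecLin
  rw [Module.finrank_fin_fun] at h4
  rw [hcard] at h3
  set k := Module.finrank F (LinearMap.ker Y.mulVecLin)
  set r := Module.finrank F (LinearMap.range Y.mulVecLin) with hr
  have h5 : n * (m - d + 1) ≤ n * ((r - (d - 1)) + (k - (d - 1))) := by
    rw [Nat.mul_add n (r - (d-1))]; omega
  have h6 := Nat.le_of_mul_le_mul_left h5 hn
  have hr0 : r ≠ 0 := by
    intro h0
    have : LinearMap.range Y.mulVecLin = ⊥ := Submodule.finrank_eq_zero.mp h0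
    rw [LinearMap.range_eq_bot] at this
    apply hY0
    ext i j
    have := congrFun (LinearMap.congr_fun this (Pi.single j 1)) i
    simpa using this
  have hk : k = 0 := by omega
  have hk : LinearMap.ker Y.mulVecLin = ⊥ := Submodule.finrank_eq_zero.mp hk
  rw [← Matrix.mulVec_injective_iff_isUnit]
  exact LinearMap.ker_eq_bot.mp hk

theorem aux_left (F : Type*) [Field F] [Fintype F] {m n d : ℕ}
    (C : Submodule F (Matrix (Fin m) (Fin n) F))
    (hC : ∀ A ∈ C, A ≠ 0 → d ≤ A.rank) (hd : 1 < d) (hdm : d ≤ m) (hn : 0 < n)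
    (hcard : Module.finrank F C = n * (m - d + 1)) :
    IsFieldOfMatrices F m (leftIdl F m n (C : Set (Matrix (Fin m) (Fin n) F))) ∧
      Nat.card (leftIdl F m n (C : Set (Matrix (Fin m) (Fin n) F))) ≤ Fintype.card F ^ m := by
  let S : Subring (Matrix (Fin m) (Fin m) F) :=
    { carrier := leftIdl F m n (C : Set (Matrix (Fin m) (Fin n) F))
      mul_mem' := fun {a b} ha hb A hA => by
        rw [Matrix.mul_assoc]; exact ha _ (hb _ hA)
      one_mem' := fun A hA => by simpa using hA
      add_mem' := fun {a b} ha hb A hA => by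
        rw [Matrix.add_mul]; exact C.add_mem (ha _ hA) (hb _ hA)
      zero_mem' := fun A hA => by simp
      neg_mem' := fun {a} ha A hA => by
        rw [Matrix.neg_mul]; exact C.neg_mem (ha _ hA) }
  have hu : ∀ a ∈ S, a ≠ 0 → IsUnit a := fun a ha h0 =>
    aux_unit C hC hd hdm hn hcard a ha h0
  have : NeZero m := ⟨by omega⟩
  have : Nontrivial (Matrix (Fin m) (Fin m) F) := inferInstance
  have : NoZeroDivisors S := ⟨fun {a b} hab => by
    by_contra! h
    have h1 := hu a.1 a.2 (fun h0 => h.1 (Subtype.ext h0))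
    have h2 : a.1 * b.1 = 0 := congrArg Subtype.val hab
    exact h.2 (Subtype.ext (h1.mul_right_eq_zero.mp h2))⟩
  have : IsDomain S := NoZeroDivisors.to_isDomain S
  have hF : IsField S := Finite.isDomain_to_isField S
  refine ⟨⟨S.zero_mem, S.one_mem, fun a ha b hb => S.add_mem ha hb, fun a ha => S.neg_mem ha,
    fun a ha b hb => S.mul_mem ha hb, fun a ha b hb => ?_, fun a ha h0 => ?_⟩, ?_⟩
  · exact congrArg Subtype.val (hF.mul_comm ⟨a, ha⟩ ⟨b, hb⟩)
  · obtain ⟨b, hb⟩ := hF.mul_inv_cancel (a := ⟨a, ha⟩) (fun h => h0 (congrArg Subtype.val h))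
    exact ⟨b.1, b.2, congrArg Subtype.val hb⟩
  · have hinj : Function.Injective (fun a : S => a.1 *ᵥ (Pi.single 0 1 : Fin m → F)) := by
      intro a b hab
      by_contra hne
      have h1 := hu _ (S.sub_mem a.2 b.2) (fun h => hne (Subtype.ext (sub_eq_zero.mp h)))
      have h2 : (a.1 - b.1) *ᵥ (Pi.single 0 1 : Fin m → F) = (a.1 - b.1) *ᵥ 0 := by
        rw [Matrix.sub_mulVec, Matrix.mulVec_zero]; exact sub_eq_zero.mpr hab
      have h3 := Matrix.mulVec_injective_iff_isUnit.mpr h1 h2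
      have := congrFun h3 0
      simp at this
    have := Nat.card_le_card_of_injective _ hinj
    rw [Nat.card_eq_fintype_card (α := Fin m → F), Fintype.card_fun, Fintype.card_fin] at this
    exact this

/-- Lunardon–Trombetti–Zhou: idealisers of linear MRD codes with
`d > 1` are finite fields, of cardinality at most `q^m` (left, when `m ≤ n`)
resp. `q^n` (right, when `m ≥ n`); in particular both are finite fields when `m = n`. -/
theorem idealisers_are_finite_fields (Fq : Type*) [Field Fq] [Fintype Fq] (m n : ℕ)
    (C : Submodule Fq (Matrix (Fin m) (Fin n) Fq)) (d : ℕ)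
    (hMRD : IsMRD Fq m n (C : Set (Matrix (Fin m) (Fin n) Fq)) d)
    (hd : 1 < d) :
    (m ≤ n →
      IsFieldOfMatrices Fq m (leftIdl Fq m n (C : Set (Matrix (Fin m) (Fin n) Fq))) ∧
      Nat.card (leftIdl Fq m n (C : Set (Matrix (Fin m) (Fin n) Fq))) ≤ Fintype.card Fq ^ m) ∧
    (n ≤ m →
      IsFieldOfMatrices Fq n (rightIdl Fq m n (C : Set (Matrix (Fin m) (Fin n) Fq))) ∧
      Nat.card (rightIdl Fq m n (C : Set (Matrix (Fin m) (Fin n) Fq))) ≤ Fintype.card Fq ^ n) := by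
  obtain ⟨⟨⟨A, hA, B, hB, hAB, hr⟩, hmin⟩, hcard⟩ := hMRD
  have hdm : d ≤ m := by
    have := (A - B).rank_le_height; omega
  have hdn : d ≤ n := by
    have := (A - B).rank_le_width; omega
  have hC : ∀ A ∈ C, A ≠ 0 → d ≤ A.rank := fun A hA h0 =>
    hmin ⟨A, hA, 0, C.zero_mem, h0, by simp⟩
  have hfr : Module.finrank Fq C = max m n * (min m n - d + 1) := by
    have h : Nat.card C = Fintype.card Fq ^ Module.finrank Fq C := by
      rw [← Nat.card_eq_fintype_card]; exact Module.natCard_eq_pow_finrank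
    exact Nat.pow_right_injective (Fintype.one_lt_card (α := Fq)) (h.symm.trans hcard)
  refine ⟨fun hmn => ?_, fun hnm => ?_⟩
  · rw [max_eq_right hmn, min_eq_left hmn] at hfr
    exact aux_left Fq C hC hd hdm (by omega) hfr
  · rw [max_eq_left hnm, min_eq_right hnm] at hfr
    let e := Matrix.transposeLinearEquiv (Fin m) (Fin n) Fq Fq
    let D : Submodule Fq (Matrix (Fin n) (Fin m) Fq) := C.map e.toLinearMap
    have hD : ∀ A, A ∈ D ↔ Aᵀ ∈ C := by
      intro A
      constructor
      · rintro ⟨B, hB, rfl⟩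
        exact hB
      · intro h
        exact ⟨Aᵀ, h, rfl⟩
    obtain ⟨⟨h0, h1, hadd, hneg, hmul, hcomm, hinv⟩, hc⟩ := aux_left Fq D (d := d)
      (fun A hA h0 => by
        rw [← Matrix.rank_transpose]
        exact hC _ ((hD A).mp hA) (by simpa using h0)) hd hdn (by omega)
      (by rw [← hfr]; exact LinearEquiv.finrank_map_eq e C)
    have hL : ∀ Z, Z ∈ rightIdl Fq m n (C : Set (Matrix (Fin m) (Fin n) Fq)) ↔
        Zᵀ ∈ leftIdl Fq n m (D : Set (Matrix (Fin n) (Fin m) Fq)) := by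
      intro Z
      constructor
      · intro h A hA
        refine (hD _).mpr ?_
        rw [Matrix.transpose_mul, Matrix.transpose_transpose]
        exact h _ ((hD _).mp hA)
      · intro h A hA
        have := (hD _).mp (h Aᵀ ((hD _).mpr (by simpa using hA)))
        simpa [Matrix.transpose_mul] using this
    refine ⟨⟨?_, ?_, ?_, ?_, ?_, ?_, ?_⟩, ?_⟩
    · rw [hL]; simpa using h0
    · rw [hL]; simpa using h1
    · intro a ha b hb
      rw [hL] at *
      simpa using hadd _ ha _ hb
    · intro a ha
      rw [hL] at *
      simpa using hneg _ ha
    · intro a ha b hb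
      rw [hL] at *
      simpa using hmul _ hb _ ha
    · intro a ha b hb
      rw [hL] at *
      apply Matrix.transpose_injective
      simpa using hcomm _ hb _ ha
    · intro a ha hne
      have ha' := (hL a).mp ha
      obtain ⟨b, hb, hab⟩ := hinv _ ha' (by simpa using hne)
      refine ⟨bᵀ, (hL _).mpr (by simpa using hb), ?_⟩
      apply Matrix.transpose_injective
      rw [hcomm _ ha' _ hb] at hab
      simpa using hab
    · refine le_trans ?_ hc
      exact Nat.card_le_card_of_injective
        (fun Z => (⟨Z.1ᵀ, (hL _).mp Z.2⟩ :
          leftIdl Fq n m (D : Set (Matrix (Fin n) (Fin m) Fq))))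
        (fun a b hab => Subtype.ext (Matrix.transpose_injective (congrArg Subtype.val hab)))
end

section
/- Let C be an F_q-linear MRD code of dimension nk in F_q^{n×n} with parameters (n,n,q;n−k+1). Then the left idealiser L(C) has maximum order q^n if and only if there exists an MRD code C' equivalent to C which is F_{q^n}-linear on the left, i.e. whose left idealiser equals F_n = {x ↦ αx : α ∈ F_{q^n}}; the analogous statement holds for the right idealiser R(C) and F_{q^n}-linearity on the right. -/
/-! Basic definitions for linearized polynomials (`q`-polynomials) over a finite
field extension `F` of `Fq`, represented by their coefficient vectors
`a : Fin n → F`, corresponding to `x ↦ ∑ i, a i * x ^ (q ^ i)` with `q = |Fq|`. -/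

section QPolyDefs

variable (Fq : Type*) [Field Fq] [Fintype Fq] {F : Type*} [Field F] [Fintype F]

/-- The map `F → F` given by the `q`-polynomial with coefficient vector `a`. -/
def qeval {n : ℕ} (a : Fin n → F) : F → F :=
  fun x => ∑ i : Fin n, a i * x ^ (Fintype.card Fq) ^ (i : ℕ)

/-- The rank of the `q`-polynomial with coefficient vector `a`, i.e. the rank of the
corresponding `Fq`-linear map `F → F`. -/
noncomputable def qrank [Algebra Fq F] {n : ℕ} (a : Fin n → F) : ℕ :=
  Module.finrank Fq (Submodule.span Fq (Set.range (qeval Fq a)))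

/-- Composition of `q`-polynomials (reduced mod `x^(q^n) - x`), on coefficient vectors. -/
def qcomp {n : ℕ} (a b : Fin n → F) : Fin n → F :=
  fun k => ∑ i : Fin n, a i * (b (k - i)) ^ (Fintype.card Fq) ^ (i : ℕ)

variable (F) in
/-- The identity `q`-polynomial `x`. -/
def qone (n : ℕ) : Fin n → F :=
  fun j => if (j : ℕ) = 0 then 1 else 0

/-- The adjoint of a `q`-polynomial: `∑ aᵢ x^(q^i) ↦ ∑ aᵢ^(q^(n-i)) x^(q^(n-i))`. -/
def qadjoint {n : ℕ} (a : Fin n → F) : Fin n → F :=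
  fun j => (a ⟨(n - (j : ℕ)) % n, Nat.mod_lt _ j.pos⟩) ^ (Fintype.card Fq) ^ (j : ℕ)

/-- The Delsarte dual of a code of `q`-polynomials, with respect to the bilinear form
`b(f,g) = Tr_{q^n/q}(∑ fᵢ gᵢ)`. -/
def qperp [Algebra Fq F] {n : ℕ} (C : Set (Fin n → F)) : Set (Fin n → F) :=
  {a | ∀ b ∈ C, Algebra.trace Fq F (∑ i : Fin n, a i * b i) = 0}

/-- Equivalence of codes of `q`-polynomials: `C' = {u ∘ f^σ ∘ v : f ∈ C}` for invertible
`q`-polynomials `u, v` and a field automorphism `σ`. -/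
def CodeEquiv {n : ℕ} (C C' : Set (Fin n → F)) : Prop :=
  ∃ (u v : Fin n → F) (σ : F ≃+* F),
    Function.Bijective (qeval Fq u) ∧ Function.Bijective (qeval Fq v) ∧
    C' = (fun a => qcomp Fq u (qcomp Fq (fun i => σ (a i)) v)) '' C

/-- The left idealiser of a code of `q`-polynomials. -/
def leftIdealiser {n : ℕ} (C : Set (Fin n → F)) : Set (Fin n → F) :=
  {φ | ∀ f ∈ C, qcomp Fq φ f ∈ C}

/-- The right idealiser of a code of `q`-polynomials. -/
def rightIdealiser {n : ℕ} (C : Set (Fin n → F)) : Set (Fin n → F) :=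
  {φ | ∀ f ∈ C, qcomp Fq f φ ∈ C}

variable (F) in
/-- The code `F_n = {x ↦ αx : α ∈ F_{q^n}}` of scalar maps. -/
def scalarCode (n : ℕ) : Set (Fin n → F) :=
  Set.range (fun α : F => fun j : Fin n => if (j : ℕ) = 0 then α else 0)

variable (F) in
/-- The generalized Gabidulin code `G_{k,s} = ⟨x, x^(q^s), …, x^(q^(s(k-1)))⟩_{F_{q^n}}`. -/
def Gcode (n s k : ℕ) : Set (Fin n → F) :=
  {a | ∃ c : Fin k → F, a = fun j : Fin n => ∑ i : Fin k, if (j : ℕ) = (s * (i : ℕ)) % n then c i else 0}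

/-- The generalized twisted Gabidulin code
`H_{k,s}(η,h) = {a₀x + a₁x^(q^s) + ⋯ + a_{k-1}x^(q^(s(k-1))) + a₀^(q^h) η x^(q^(sk))}`. -/
def Hcode (n s k : ℕ) (h : ℤ) (η : F) : Set (Fin n → F) :=
  {a | ∃ c : Fin k → F, a = fun j : Fin n =>
    (∑ i : Fin k, if (j : ℕ) = (s * (i : ℕ)) % n then c i else 0) +
    (if hk : 0 < k then
      (if (j : ℕ) = (s * k) % n then
        η * (c ⟨0, hk⟩) ^ (Fintype.card Fq) ^ (h % (n : ℤ)).toNat else 0)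
    else 0)}

/-- Coefficientwise `q^m`-th power of a `q`-polynomial: `f ↦ f^{[m]}`. -/
def frobvec {n : ℕ} (m : ℕ) (a : Fin n → F) : Fin n → F :=
  fun i => (a i) ^ (Fintype.card Fq) ^ m

/-- `C^{[m]} = {f^{[m]} : f ∈ C}`. -/
def frobCode {n : ℕ} (m : ℕ) (C : Set (Fin n → F)) : Set (Fin n → F) :=
  frobvec Fq m '' C

/-- `S` is a finite field under addition and composition of `q`-polynomials. -/
def IsSubfieldCode {n : ℕ} (S : Set (Fin n → F)) : Prop :=
  (0 : Fin n → F) ∈ S ∧ qone F n ∈ S ∧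
  (∀ a ∈ S, ∀ b ∈ S, a + b ∈ S) ∧
  (∀ a ∈ S, -a ∈ S) ∧
  (∀ a ∈ S, ∀ b ∈ S, qcomp Fq a b ∈ S) ∧
  (∀ a ∈ S, ∀ b ∈ S, qcomp Fq a b = qcomp Fq b a) ∧
  (∀ a ∈ S, a ≠ 0 → ∃ b ∈ S, qcomp Fq a b = qone F n)

end QPolyDefs


open Module in
theorem exists_basis_adapted {K V : Type*} [Field K] [AddCommGroup V] [Module K V]
    [FiniteDimensional K V] (n : ℕ) (hn : finrank K V = n) (I : Submodule K V) :
    ∃ b : Basis (Fin n) K V, (∀ i : Fin n, i.1 < finrank K I → b i ∈ I) ∧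
      I ≤ Submodule.span K (b '' {i | i.1 < finrank K I}) := by
  obtain ⟨J, hJ⟩ := Submodule.exists_isCompl I
  let bI := finBasis K I
  let bJ := finBasis K J
  have hsum : finrank K I + finrank K J = n := by
    rw [← hn]; exact Submodule.finrank_add_eq_of_isCompl hJ
  let e : Fin (finrank K I) ⊕ Fin (finrank K J) ≃ Fin n := finSumFinEquiv.trans (finCongr hsum)
  let b : Basis (Fin n) K V := ((bI.prod bJ).map (Submodule.prodEquivOfIsCompl I J hJ)).reindex e
  have key : ∀ (i : Fin n) (h : i.1 < finrank K I), b i = bI ⟨i.1, h⟩ := by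
    intro i h
    have : e.symm i = Sum.inl ⟨i.1, h⟩ := by
      rw [Equiv.symm_apply_eq]; ext; simp [e]
    simp [b, this]
  refine ⟨b, fun i h => by rw [key i h]; exact Submodule.coe_mem _, ?_⟩
  intro v hv
  have h1 : (⟨v, hv⟩ : I) ∈ Submodule.span K (Set.range bI) := by rw [bI.span_eq]; trivial
  have h2 := Submodule.mem_map_of_mem (f := I.subtype) h1
  rw [Submodule.map_span] at h2
  refine Submodule.span_mono ?_ h2
  rintro _ ⟨_, ⟨j, rfl⟩, rfl⟩
  have hlt : j.1 < n := by have := j.2; omega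
  exact ⟨⟨j.1, hlt⟩, j.2, by rw [key ⟨j.1, hlt⟩ j.2]; rfl⟩

open Module in
theorem right_inj_of_mrd {K V W : Type*} [Field K] [AddCommGroup V] [Module K V]
    [FiniteDimensional K V] [AddCommGroup W] [Module K W] [FiniteDimensional K W]
    (n k : ℕ) (hV : finrank K V = n) (hW : finrank K W = n) (hk1 : 1 ≤ k) (hkn : k < n)
    (D : Submodule K (V →ₗ[K] W)) (hdim : finrank K D = n * k)
    (hD : ∀ f ∈ D, f ≠ 0 → n - k + 1 ≤ finrank K (LinearMap.range f))
    (φ : V →ₗ[K] V) (hφ0 : φ ≠ 0) (hφ : ∀ f ∈ D, f ∘ₗ φ ∈ D) : Function.Injective φ := by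
  classical
  by_contra hinj
  have hr : finrank K (LinearMap.range φ) < n := by
    rw [← hV]
    apply Submodule.finrank_lt
    intro h
    exact hinj (LinearMap.injective_iff_surjective.mpr (LinearMap.range_eq_top.mp h))
  have hr0 : 0 < finrank K (LinearMap.range φ) := by
    rw [Nat.pos_iff_ne_zero]
    intro h
    exact hφ0 (LinearMap.range_eq_bot.mp (Submodule.finrank_eq_zero.mp h))
  obtain ⟨b, hb1, hb2⟩ := exists_basis_adapted n hV (LinearMap.range φ)
  set r := finrank K (LinearMap.range φ) with hrdef
  let T : D →ₗ[K] (Fin k → W) :=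
    { toFun := fun f i => f.1 (b (Fin.castLE hkn.le i))
      map_add' := fun f g => by ext i; simp
      map_smul' := fun c f => by ext i; simp }
  have hTinj : Function.Injective T := by
    rw [← LinearMap.ker_eq_bot, LinearMap.ker_eq_bot']
    rintro ⟨f, hf⟩ h0
    by_contra hne
    have hf0 : f ≠ 0 := fun h => hne (by ext1; exact h)
    have h1 := hD f hf hf0
    have h2 : LinearMap.range f ≤ Submodule.span K
        ((Finset.univ.filter (fun i : Fin n => k ≤ i.1)).image (fun i => f (b i)) : Finset W) := by
      rw [LinearMap.range_eq_map, ← b.span_eq, Submodule.map_span, Submodule.span_le]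
      rintro _ ⟨_, ⟨i, rfl⟩, rfl⟩
      by_cases hi : k ≤ i.1
      · apply Submodule.subset_span
        simp only [Finset.coe_image]
        exact ⟨i, by simpa using hi, rfl⟩
      · have := congrFun h0 ⟨i.1, by omega⟩
        have h3 : f (b i) = 0 := this
        rw [h3]; exact Submodule.zero_mem _
    have h3 := (Submodule.finrank_mono h2).trans (finrank_span_finset_le_card _)
    have h4 : (Finset.univ.filter (fun i : Fin n => k ≤ i.1)).card ≤ n - k := by
      have := Finset.card_le_card_of_injOn (s := Finset.univ.filter (fun i : Fin n => k ≤ i.1))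
        (t := Finset.Ico k n) (fun i => i.1) (by intro i hi; simp at hi ⊢; exact hi)
        (Fin.val_injective.injOn)
      simpa using this
    have h5 := h3.trans (Finset.card_image_le.trans h4)
    omega
  have hTsurj : Function.Surjective T := by
    rw [← LinearMap.injective_iff_surjective_of_finrank_eq_finrank]
    · exact hTinj
    · rw [hdim, Module.finrank_pi_fintype]; simp [hW, mul_comm]
  have hWnt : Nontrivial W := Module.nontrivial_of_finrank_pos (R := K) (by omega)
  obtain ⟨w, hw⟩ := exists_ne (0 : W)
  obtain ⟨⟨f, hf⟩, hfT⟩ := hTsurj (Pi.single ⟨0, hk1⟩ w)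
  have hf0 : f (b ⟨0, by omega⟩) = w := by
    have := congrFun hfT ⟨0, hk1⟩
    rw [Pi.single_eq_same] at this
    exact this
  have hfi : ∀ i : Fin n, i.1 < k → i.1 ≠ 0 → f (b i) = 0 := by
    intro i hi hi0
    have := congrFun hfT ⟨i.1, hi⟩
    rw [Pi.single_eq_of_ne (by simpa [Fin.ext_iff] using hi0)] at this
    exact this
  have hne : f ∘ₗ φ ≠ 0 := by
    intro h
    obtain ⟨x, hx⟩ := hb1 ⟨0, by omega⟩ hr0
    apply hw
    rw [← hf0, ← hx]
    exact LinearMap.congr_fun h x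
  have h1 := hD _ (hφ f hf) hne
  have h2 : LinearMap.range (f ∘ₗ φ) ≤ Submodule.span K
      ((insert ⟨0, by omega⟩ (Finset.univ.filter (fun i : Fin n => k ≤ i.1 ∧ i.1 < r))).image
        (fun i => f (b i)) : Finset W) := by
    rw [LinearMap.range_comp]
    refine (Submodule.map_mono hb2).trans ?_
    rw [Submodule.map_span, Submodule.span_le]
    rintro _ ⟨_, ⟨i, hi, rfl⟩, rfl⟩
    have hi : i.1 < r := hi
    by_cases hik : k ≤ i.1 ∨ i.1 = 0
    · apply Submodule.subset_span
      rw [Finset.coe_image]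
      refine ⟨i, ?_, rfl⟩
      rcases hik with h | h
      · simp [h, hi]
      · have h0 : i = ⟨0, by omega⟩ := Fin.ext h
        rw [h0]; exact Finset.mem_coe.mpr (Finset.mem_insert_self _ _)
    · rw [hfi i (by omega) (by omega)]; exact Submodule.zero_mem _
  have h3 := (Submodule.finrank_mono h2).trans (finrank_span_finset_le_card _)
  have h4 : (Finset.univ.filter (fun i : Fin n => k ≤ i.1 ∧ i.1 < r)).card ≤ r - k := by
    have := Finset.card_le_card_of_injOn
      (s := Finset.univ.filter (fun i : Fin n => k ≤ i.1 ∧ i.1 < r))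
      (t := Finset.Ico k r) (fun i => i.1) (by intro i hi; simp at hi ⊢; exact hi)
      (Fin.val_injective.injOn)
    simpa using this
  have h5 := h3.trans (Finset.card_image_le.trans (Finset.card_insert_le _ _))
  omega

open Module in
theorem transpose_zero_imp {K V W : Type*} [Field K] [AddCommGroup V] [Module K V]
    [AddCommGroup W] [Module K W] [FiniteDimensional K V] [FiniteDimensional K W]
    (f : V →ₗ[K] W) (h : Dual.transpose (R := K) f = 0) : f = 0 := by
  have h1 := LinearMap.finrank_range_dualMap_eq_finrank_range f
  rw [LinearMap.dualMap_def, h, LinearMap.range_zero, finrank_bot] at h1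
  exact LinearMap.range_eq_bot.mp (Submodule.finrank_eq_zero.mp h1.symm)

open Module in
theorem left_inj_of_mrd {K V W : Type*} [Field K] [AddCommGroup V] [Module K V]
    [FiniteDimensional K V] [AddCommGroup W] [Module K W] [FiniteDimensional K W]
    (n k : ℕ) (hV : finrank K V = n) (hW : finrank K W = n) (hk1 : 1 ≤ k) (hkn : k < n)
    (D : Submodule K (V →ₗ[K] W)) (hdim : finrank K D = n * k)
    (hD : ∀ f ∈ D, f ≠ 0 → n - k + 1 ≤ finrank K (LinearMap.range f))
    (φ : W →ₗ[K] W) (hφ0 : φ ≠ 0) (hφ : ∀ f ∈ D, φ ∘ₗ f ∈ D) : Function.Injective φ := by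
  have hinj : Function.Injective (Dual.transpose (R := K) (M := V) (M' := W)) :=
    (injective_iff_map_eq_zero _).mpr fun f h => transpose_zero_imp f h
  have := right_inj_of_mrd n k (V := Dual K W) (W := Dual K V)
    (by rw [Subspace.dual_finrank_eq, hW]) (by rw [Subspace.dual_finrank_eq, hV]) hk1 hkn
    (D.map Dual.transpose)
    (by rw [← hdim]; exact (LinearEquiv.finrank_eq (Submodule.equivMapOfInjective _ hinj D)).symm)
    (by
      rintro _ ⟨f, hf, rfl⟩ h0
      have h1 := LinearMap.finrank_range_dualMap_eq_finrank_range f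
      rw [LinearMap.dualMap_def] at h1
      rw [h1]
      exact hD f hf (by rintro rfl; simp at h0))
    φ.dualMap (fun h => hφ0 (transpose_zero_imp _ h))
    (by
      rintro _ ⟨f, hf, rfl⟩
      exact ⟨φ ∘ₗ f, hφ f hf, Dual.transpose_comp _ _⟩)
  rw [LinearMap.dualMap_injective_iff] at this
  exact LinearMap.injective_iff_surjective.mpr this

open Module in
theorem conj_scalar (Fq F : Type*) [Field Fq] [Fintype Fq] [Field F] [Fintype F] [Algebra Fq F]
    (A : Subalgebra Fq (Module.End Fq F))
    (hcard : Nat.card A = Fintype.card Fq ^ finrank Fq F)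
    (hinj : ∀ φ ∈ A, φ ≠ 0 → Function.Injective φ) :
    ∃ h : (Module.End Fq F)ˣ, ∀ φ : Module.End Fq F,
      (h : Module.End Fq F) * φ * (↑h⁻¹ : Module.End Fq F) ∈ A ↔ ∃ α : F, φ = LinearMap.mulLeft Fq α := by
  have : Finite (Module.End Fq F) := Module.finite_of_finite Fq
  have : NoZeroDivisors A := ⟨by
    rintro ⟨a, ha⟩ ⟨b, hb⟩ hab
    by_contra! hcon
    have ha0 : a ≠ 0 := fun h => hcon.1 (by ext1; exact h)
    apply hcon.2
    ext x
    apply hinj a ha ha0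
    have := congrArg (fun z : A => z.1 x) hab
    simpa using this⟩
  have : IsDomain A := NoZeroDivisors.to_isDomain A
  let _ : Field A := (Finite.isDomain_to_isField A).toField
  have hfr : finrank Fq A = finrank Fq F := by
    have h := Module.natCard_eq_pow_finrank (K := Fq) (V := A)
    rw [hcard, Nat.card_eq_fintype_card] at h
    exact (Nat.pow_right_injective (Fintype.one_lt_card (α := Fq)) h).symm
  obtain ⟨ι⟩ := FiniteField.nonempty_algHom_of_finrank_dvd (F := Fq) (K := F) (L := A) (by rw [hfr])
  have hιinj : Function.Injective ι := ι.toRingHom.injective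
  have hιsurj : Function.Surjective ι :=
    (LinearMap.injective_iff_surjective_of_finrank_eq_finrank (f := ι.toLinearMap) hfr.symm).mp hιinj
  let g : F →ₗ[Fq] F :=
    { toFun := fun α => (ι α).1 1
      map_add' := fun x y => by rw [map_add]; rfl
      map_smul' := fun c x => by rw [map_smul]; rfl }
  have hg : Function.Injective g := by
    rw [← LinearMap.ker_eq_bot, LinearMap.ker_eq_bot']
    intro α hα
    by_contra hne
    have h1 : (ι α).1 ≠ 0 := fun h => hne (hιinj (by rw [map_zero]; ext1; exact h))
    have := hinj _ (ι α).2 h1 (a₁ := 1) (a₂ := 0) (by rw [map_zero]; exact hα)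
    exact one_ne_zero this
  have hgu : IsUnit (g : Module.End Fq F) := by
    rw [Module.End.isUnit_iff]
    exact ⟨hg, LinearMap.injective_iff_surjective.mp hg⟩
  obtain ⟨h, hh⟩ := hgu
  have hcomm : ∀ α : F, (h : Module.End Fq F) * LinearMap.mulLeft Fq α = (ι α).1 * h := by
    intro α
    ext x
    rw [hh]
    change (ι (α * x)).1 1 = (ι α).1 ((ι x).1 1)
    rw [map_mul]; rfl
  refine ⟨h, fun φ => ⟨fun hφ => ?_, ?_⟩⟩
  · obtain ⟨α, hα⟩ := hιsurj ⟨_, hφ⟩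
    refine ⟨α, ?_⟩
    have h1 := hcomm α
    rw [hα] at h1
    simp only [Units.inv_mul_cancel_right] at h1
    exact (h.isUnit.mul_right_injective h1).symm
  · rintro ⟨α, rfl⟩
    rw [hcomm, Units.mul_inv_cancel_right]
    exact (ι α).2

theorem card_left_conj {M : Type*} [Monoid M] (D : Set M) (s : M ≃* M) (u v : Mˣ) :
    Nat.card {φ : M | ∀ f ∈ (fun a => (u : M) * (s a * v)) '' D,
      φ * f ∈ (fun a => (u : M) * (s a * v)) '' D} = Nat.card {φ : M | ∀ f ∈ D, φ * f ∈ D} := by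
  symm
  have hinj : Function.Injective (fun a => (u : M) * (s a * v)) := by
    intro a b h
    exact s.injective (v.isUnit.mul_left_injective (u.isUnit.mul_right_injective h))
  let e : M ≃ M := s.toEquiv.trans ⟨fun x => u * x * ↑u⁻¹, fun x => ↑u⁻¹ * x * u,
    fun x => by simp [mul_assoc], fun x => by simp [mul_assoc]⟩
  refine Nat.card_congr (Equiv.subtypeEquiv e fun φ => ?_)
  change (∀ f ∈ D, φ * f ∈ D) ↔ ∀ f ∈ _, (u * s φ * ↑u⁻¹) * f ∈ _
  rw [Set.forall_mem_image]
  refine forall₂_congr fun f hf => ?_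
  rw [show (u : M) * s φ * ↑u⁻¹ * (↑u * (s f * ↑v)) = (fun a => (u : M) * (s a * v)) (φ * f) by
    simp [mul_assoc], hinj.mem_set_image]

theorem card_right_conj {M : Type*} [Monoid M] (D : Set M) (s : M ≃* M) (u v : Mˣ) :
    Nat.card {φ : M | ∀ f ∈ (fun a => (u : M) * (s a * v)) '' D,
      f * φ ∈ (fun a => (u : M) * (s a * v)) '' D} = Nat.card {φ : M | ∀ f ∈ D, f * φ ∈ D} := by
  symm
  have hinj : Function.Injective (fun a => (u : M) * (s a * v)) := by
    intro a b h
    exact s.injective (v.isUnit.mul_left_injective (u.isUnit.mul_right_injective h))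
  let e : M ≃ M := s.toEquiv.trans ⟨fun x => ↑v⁻¹ * x * v, fun x => v * x * ↑v⁻¹,
    fun x => by simp [mul_assoc], fun x => by simp [mul_assoc]⟩
  refine Nat.card_congr (Equiv.subtypeEquiv e fun φ => ?_)
  change (∀ f ∈ D, f * φ ∈ D) ↔ ∀ f ∈ _, f * (↑v⁻¹ * s φ * v) ∈ _
  rw [Set.forall_mem_image]
  refine forall₂_congr fun f hf => ?_
  rw [show ((u : M) * (s f * v)) * (↑v⁻¹ * s φ * v) = (fun a => (u : M) * (s a * v)) (f * φ) by
    simp [mul_assoc], hinj.mem_set_image]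

section Transfer

variable (Fq : Type*) [Field Fq] [Fintype Fq] {F : Type*} [Field F] [Fintype F] [Algebra Fq F]

open Module

noncomputable def qEnd {n : ℕ} : (Fin n → F) →ₗ[Fq] Module.End Fq F where
  toFun a := ∑ i : Fin n,
    LinearMap.mulLeft Fq (a i) ∘ₗ (FiniteField.frobeniusAlgHom Fq F ^ (i : ℕ)).toLinearMap
  map_add' a b := by
    ext x; simp [add_mul, Finset.sum_add_distrib]
  map_smul' c a := by
    ext x; simp [Finset.smul_sum]

theorem frob_pow_apply (m : ℕ) (x : F) :
    (FiniteField.frobeniusAlgHom Fq F ^ m) x = x ^ Fintype.card Fq ^ m := by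
  rw [AlgHom.coe_pow, FiniteField.coe_frobeniusAlgHom, pow_iterate]

theorem qEnd_apply {n : ℕ} (a : Fin n → F) (x : F) : qEnd Fq a x = qeval Fq a x := by
  simp [qEnd, qeval, FiniteField.coe_frobeniusAlgHom, pow_iterate]

theorem qEnd_coe {n : ℕ} (a : Fin n → F) : ⇑(qEnd Fq a) = qeval Fq a :=
  funext (qEnd_apply Fq a)

theorem qEnd_injective {n : ℕ} (hn : finrank Fq F = n) :
    Function.Injective (qEnd Fq (F := F) (n := n)) := by
  subst hn
  refine (injective_iff_map_eq_zero _).mpr fun a h => ?_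
  have hli := (linearIndependent_monoidHom F F).comp
    (fun i : Fin (finrank Fq F) => ((FiniteField.frobeniusAlgHom Fq F ^ (i : ℕ) : F →ₐ[Fq] F) : F →* F))
    (by
      intro i j hij
      apply (FiniteField.bijective_frobeniusAlgHom_pow Fq F).1
      ext x
      exact DFunLike.congr_fun hij x)
  rw [Fintype.linearIndependent_iff] at hli
  funext i
  refine hli a ?_ i
  funext x
  have := LinearMap.congr_fun h x
  simpa [qEnd] using this

theorem qEnd_mul {n : ℕ} (hn : finrank Fq F = n) (a b : Fin n → F) :
    qEnd Fq (qcomp Fq a b) = qEnd Fq a * qEnd Fq b := by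
  ext x
  rw [Module.End.mul_apply, qEnd_apply, qEnd_apply, qEnd_apply]
  have hn0 : 0 < n := hn ▸ finrank_pos
  have : NeZero n := ⟨hn0.ne'⟩
  unfold qeval qcomp
  simp_rw [Finset.sum_mul]
  rw [Finset.sum_comm]
  refine Finset.sum_congr rfl fun i _ => ?_
  rw [← frob_pow_apply Fq i.1 (∑ j : Fin n, _), map_sum, Finset.mul_sum]
  rw [← Equiv.sum_comp (Equiv.addRight i)]
  refine Finset.sum_congr rfl fun j _ => ?_
  rw [frob_pow_apply]
  simp only [Equiv.coe_addRight, add_sub_cancel_right, mul_pow, mul_assoc]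
  congr 2
  rw [← pow_mul, ← pow_add, Fin.val_add]
  have hmod : ∀ m : ℕ, x ^ Fintype.card Fq ^ m = x ^ Fintype.card Fq ^ (m % n) := by
    intro m
    rw [← frob_pow_apply, ← frob_pow_apply, ← hn, ← FiniteField.orderOf_frobeniusAlgHom Fq F,
      pow_mod_orderOf]
  exact (hmod _).symm

noncomputable def qEquiv {n : ℕ} (hn : finrank Fq F = n) : (Fin n → F) ≃ₗ[Fq] Module.End Fq F :=
  LinearEquiv.ofBijective (qEnd Fq) ⟨qEnd_injective Fq hn,
    (LinearMap.injective_iff_surjective_of_finrank_eq_finrank (by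
      rw [finrank_linearMap, finrank_pi_fintype]; simp [hn])).mp (qEnd_injective Fq hn)⟩

theorem qEquiv_apply {n : ℕ} (hn : finrank Fq F = n) (a : Fin n → F) :
    qEquiv Fq hn a = qEnd Fq a := rfl

theorem qEquiv_mul {n : ℕ} (hn : finrank Fq F = n) (a b : Fin n → F) :
    qEquiv Fq hn (qcomp Fq a b) = qEquiv Fq hn a * qEquiv Fq hn b := qEnd_mul Fq hn a b

theorem qrank_eq {n : ℕ} (a : Fin n → F) :
    qrank Fq a = finrank Fq (LinearMap.range (qEnd Fq a)) := by
  unfold qrank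
  rw [← qEnd_coe, ← LinearMap.coe_range, Submodule.span_eq]

theorem qEquiv_isUnit {n : ℕ} (hn : finrank Fq F = n) (a : Fin n → F) :
    IsUnit (qEquiv Fq hn a) ↔ Function.Bijective (qeval Fq a) := by
  rw [Module.End.isUnit_iff, qEquiv_apply, qEnd_coe]

theorem qEquiv_scalar {n : ℕ} (hn : finrank Fq F = n) (α : F) :
    qEquiv Fq hn (fun j : Fin n => if (j : ℕ) = 0 then α else 0) = LinearMap.mulLeft Fq α := by
  ext x
  have hn0 : 0 < n := hn ▸ finrank_pos
  rw [qEquiv_apply, qEnd_apply]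
  unfold qeval
  rw [Finset.sum_eq_single ⟨0, hn0⟩]
  · simp
  · intro j _ hj
    have h0 : (j : ℕ) ≠ 0 := fun h => hj (Fin.ext h)
    simp [h0]
  · simp

theorem mem_scalarCode_iff {n : ℕ} (hn : finrank Fq F = n) (φ : Fin n → F) :
    φ ∈ scalarCode F n ↔ ∃ α : F, qEquiv Fq hn φ = LinearMap.mulLeft Fq α := by
  unfold scalarCode
  constructor
  · rintro ⟨α, rfl⟩; exact ⟨α, qEquiv_scalar Fq hn α⟩
  · rintro ⟨α, h⟩
    exact ⟨α, (qEquiv Fq hn).injective (by rw [h]; exact qEquiv_scalar Fq hn α)⟩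

theorem card_scalarCode {n : ℕ} (hn : finrank Fq F = n) :
    Nat.card (scalarCode F n) = Fintype.card Fq ^ n := by
  have hn0 : 0 < n := hn ▸ finrank_pos
  unfold scalarCode
  rw [Nat.card_range_of_injective]
  · rw [Module.natCard_eq_pow_finrank (K := Fq), hn, Nat.card_eq_fintype_card]
  · intro a b h
    simpa using congrFun h ⟨0, hn0⟩

theorem mem_left_iff {n : ℕ} (hn : finrank Fq F = n) (C : Set (Fin n → F)) (φ : Fin n → F) :
    φ ∈ leftIdealiser Fq C ↔
      ∀ f ∈ qEquiv Fq hn '' C, qEquiv Fq hn φ * f ∈ qEquiv Fq hn '' C := by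
  rw [Set.forall_mem_image]
  refine forall₂_congr fun f hf => ?_
  rw [← qEquiv_mul, (qEquiv Fq hn).injective.mem_set_image]

theorem mem_right_iff {n : ℕ} (hn : finrank Fq F = n) (C : Set (Fin n → F)) (φ : Fin n → F) :
    φ ∈ rightIdealiser Fq C ↔
      ∀ f ∈ qEquiv Fq hn '' C, f * qEquiv Fq hn φ ∈ qEquiv Fq hn '' C := by
  rw [Set.forall_mem_image]
  refine forall₂_congr fun f hf => ?_
  rw [← qEquiv_mul, (qEquiv Fq hn).injective.mem_set_image]

theorem card_left_eq {n : ℕ} (hn : finrank Fq F = n) (C : Set (Fin n → F)) :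
    Nat.card (leftIdealiser Fq C) = Nat.card {φ : Module.End Fq F |
      ∀ f ∈ qEquiv Fq hn '' C, φ * f ∈ qEquiv Fq hn '' C} :=
  Nat.card_congr (Equiv.subtypeEquiv (qEquiv Fq hn).toEquiv (mem_left_iff Fq hn C))

theorem card_right_eq {n : ℕ} (hn : finrank Fq F = n) (C : Set (Fin n → F)) :
    Nat.card (rightIdealiser Fq C) = Nat.card {φ : Module.End Fq F |
      ∀ f ∈ qEquiv Fq hn '' C, f * φ ∈ qEquiv Fq hn '' C} :=
  Nat.card_congr (Equiv.subtypeEquiv (qEquiv Fq hn).toEquiv (mem_right_iff Fq hn C))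

theorem qcomp_sigma {n : ℕ} (σ : F ≃+* F) (a b : Fin n → F) :
    (fun i => σ (qcomp Fq a b i)) = qcomp Fq (fun i => σ (a i)) (fun i => σ (b i)) := by
  funext k
  simp [qcomp]

noncomputable def sigmaE {n : ℕ} (hn : finrank Fq F = n) (σ : F ≃+* F) :
    Module.End Fq F ≃* Module.End Fq F where
  toEquiv := ((qEquiv Fq hn).toEquiv.symm.trans (Equiv.piCongrRight fun _ => σ.toEquiv)).trans
    (qEquiv Fq hn).toEquiv
  map_mul' x y := by
    obtain ⟨a, rfl⟩ := (qEquiv Fq hn).surjective x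
    obtain ⟨b, rfl⟩ := (qEquiv Fq hn).surjective y
    have h : ∀ c, (((qEquiv Fq hn).toEquiv.symm.trans
      (Equiv.piCongrRight fun _ => σ.toEquiv)).trans (qEquiv Fq hn).toEquiv) (qEquiv Fq hn c)
        = qEquiv Fq hn (fun i => σ (c i)) := by
      intro c
      change qEquiv Fq hn (fun i => σ ((qEquiv Fq hn).symm (qEquiv Fq hn c) i)) = _
      rw [LinearEquiv.symm_apply_apply]
    change (((qEquiv Fq hn).toEquiv.symm.trans
      (Equiv.piCongrRight fun _ => σ.toEquiv)).trans (qEquiv Fq hn).toEquiv) _ =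
      (((qEquiv Fq hn).toEquiv.symm.trans
      (Equiv.piCongrRight fun _ => σ.toEquiv)).trans (qEquiv Fq hn).toEquiv) _ *
      (((qEquiv Fq hn).toEquiv.symm.trans
      (Equiv.piCongrRight fun _ => σ.toEquiv)).trans (qEquiv Fq hn).toEquiv) _
    rw [← qEquiv_mul, h, h, h, ← qEquiv_mul, qcomp_sigma]

theorem sigmaE_apply {n : ℕ} (hn : finrank Fq F = n) (σ : F ≃+* F) (c : Fin n → F) :
    sigmaE Fq hn σ (qEquiv Fq hn c) = qEquiv Fq hn (fun i => σ (c i)) := by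
  change qEquiv Fq hn (fun i => σ ((qEquiv Fq hn).symm (qEquiv Fq hn c) i)) = _
  rw [LinearEquiv.symm_apply_apply]

theorem codeEquiv_image {n : ℕ} (hn : finrank Fq F = n) {C C' : Set (Fin n → F)}
    (h : CodeEquiv Fq C C') : ∃ (s : Module.End Fq F ≃* Module.End Fq F)
      (u v : (Module.End Fq F)ˣ), qEquiv Fq hn '' C' =
        (fun a => (u : Module.End Fq F) * (s a * v)) '' (qEquiv Fq hn '' C) := by
  obtain ⟨u, v, σ, hu, hv, rfl⟩ := h
  rw [← qEquiv_isUnit Fq hn] at hu hv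
  refine ⟨sigmaE Fq hn σ, hu.unit, hv.unit, ?_⟩
  rw [Set.image_image, Set.image_image]
  refine Set.image_congr fun a _ => ?_
  rw [qEquiv_mul, qEquiv_mul, sigmaE_apply, IsUnit.unit_spec, IsUnit.unit_spec]

/-- Transport of a code by units, with trivial automorphism. -/
theorem exists_code {n : ℕ} (hn : finrank Fq F = n) (N d : ℕ)
    (C : Set (Fin n → F)) (hC : Nat.card C = N) (hr : ∀ a ∈ C, a ≠ 0 → d ≤ qrank Fq a)
    (u v : (Module.End Fq F)ˣ) :
    ∃ C' : Set (Fin n → F), CodeEquiv Fq C C' ∧ Nat.card C' = N ∧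
      (∀ a ∈ C', a ≠ 0 → d ≤ qrank Fq a) ∧
      qEquiv Fq hn '' C' =
        (fun a => (u : Module.End Fq F) * (a * v)) '' (qEquiv Fq hn '' C) := by
  set u' := (qEquiv Fq hn).symm u with hu'
  set v' := (qEquiv Fq hn).symm v with hv'
  have hu : qEquiv Fq hn u' = u := LinearEquiv.apply_symm_apply _ _
  have hv : qEquiv Fq hn v' = v := LinearEquiv.apply_symm_apply _ _
  have hT : ∀ a, qEquiv Fq hn (qcomp Fq u' (qcomp Fq a v')) = u * (qEquiv Fq hn a * v) := by
    intro a; rw [qEquiv_mul, qEquiv_mul, hu, hv]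
  have hinj : Function.Injective (fun a => (u : Module.End Fq F) * (a * v)) := by
    intro a b h
    exact v.isUnit.mul_left_injective (u.isUnit.mul_right_injective h)
  refine ⟨(fun a => qcomp Fq u' (qcomp Fq a v')) '' C, ⟨u', v', RingEquiv.refl F, ?_, ?_, rfl⟩,
    ?_, ?_, ?_⟩
  · rw [← qEquiv_isUnit Fq hn, hu]; exact u.isUnit
  · rw [← qEquiv_isUnit Fq hn, hv]; exact v.isUnit
  · rw [Nat.card_image_of_injective, hC]
    intro a b h
    apply (qEquiv Fq hn).injective
    apply hinj
    have := congrArg (qEquiv Fq hn) h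
    simpa only [hT] using this
  · rintro _ ⟨a, ha, rfl⟩ hne
    have ha0 : a ≠ 0 := by
      rintro rfl
      apply hne
      apply (qEquiv Fq hn).injective
      simp only [hT, map_zero, zero_mul, mul_zero]
    refine (hr a ha ha0).trans (le_of_eq ?_)
    rw [qrank_eq, qrank_eq, ← qEquiv_apply Fq hn, ← qEquiv_apply Fq hn, hT]
    have hub := (Module.End.isUnit_iff _).mp u.isUnit
    have hvb := (Module.End.isUnit_iff _).mp v.isUnit
    rw [Module.End.mul_eq_comp, Module.End.mul_eq_comp, LinearMap.range_comp,
      LinearMap.range_comp_of_range_eq_top _ (LinearMap.range_eq_top.mpr hvb.2)]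
    exact (LinearEquiv.finrank_eq (Submodule.equivMapOfInjective _ hub.1 _))
  · rw [Set.image_image, Set.image_image]
    exact Set.image_congr fun a _ => hT a

theorem inj_of_top (A : Subalgebra Fq (Module.End Fq F)) (hA : A = ⊤)
    (hcard : Nat.card A = Fintype.card Fq ^ finrank Fq F) (φ : Module.End Fq F) (h0 : φ ≠ 0) :
    Function.Injective φ := by
  have hfr : finrank Fq A = finrank Fq F := by
    have h := Module.natCard_eq_pow_finrank (K := Fq) (V := A)
    rw [hcard, Nat.card_eq_fintype_card] at h
    exact (Nat.pow_right_injective (Fintype.one_lt_card (α := Fq)) h).symm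
  have hp : 0 < finrank Fq F := finrank_pos
  have h2 : finrank Fq (Module.End Fq F) = finrank Fq F := by
    rw [← hfr, hA]; exact (subalgebra_top_finrank_eq_submodule_top_finrank.trans (finrank_top _ _)).symm
  have h1 : finrank Fq (Module.End Fq F) = 1 := by
    have h3 := h2
    rw [finrank_linearMap] at h3
    rw [h2]
    exact Nat.eq_of_mul_eq_mul_left hp (by rw [h3, mul_one])
  obtain ⟨c, hc⟩ := (finrank_eq_one_iff_of_nonzero' φ h0).mp h1 1
  intro x y hxy
  have e : ∀ z, z = c • φ z := fun z => (LinearMap.congr_fun hc z).symm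
  rw [e x, e y, hxy]

def leftAlg (D : Submodule Fq (Module.End Fq F)) : Subalgebra Fq (Module.End Fq F) where
  carrier := {φ | ∀ f ∈ D, φ * f ∈ D}
  mul_mem' := fun {a b} ha hb f hf => by rw [mul_assoc]; exact ha _ (hb _ hf)
  add_mem' := fun {a b} ha hb f hf => by rw [add_mul]; exact D.add_mem (ha _ hf) (hb _ hf)
  algebraMap_mem' := fun c f hf => by
    rw [← Algebra.smul_def]; exact D.smul_mem c hf

def rightAlg (D : Submodule Fq (Module.End Fq F)) : Subalgebra Fq (Module.End Fq F) where
  carrier := {φ | ∀ f ∈ D, f * φ ∈ D}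
  mul_mem' := fun {a b} ha hb f hf => by rw [← mul_assoc]; exact hb _ (ha _ hf)
  add_mem' := fun {a b} ha hb f hf => by rw [mul_add]; exact D.add_mem (ha _ hf) (hb _ hf)
  algebraMap_mem' := fun c f hf => by
    rw [← Algebra.commutes, ← Algebra.smul_def]; exact D.smul_mem c hf

end Transfer

/-- for an `Fq`-linear MRD code `C` of dimension `nk` with parameters
`(n,n,q;n−k+1)`, the left (resp. right) idealiser has maximum order `q^n` iff `C` is
equivalent to an MRD code which is `F_{q^n}`-linear on the left (resp. right). -/
theorem max_idealiser_iff_equivalent_linear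
    (Fq F : Type*) [Field Fq] [Fintype Fq] [Field F] [Fintype F] [Algebra Fq F]
    (n k : ℕ) (hn : Module.finrank Fq F = n) (hk1 : 1 ≤ k) (hkn : k ≤ n)
    (C : Submodule Fq (Fin n → F))
    (hdim : Module.finrank Fq C = n * k)
    (hMRD : ∀ a ∈ C, a ≠ 0 → n - k + 1 ≤ qrank Fq a) :
    (Nat.card (leftIdealiser Fq (C : Set (Fin n → F))) = Fintype.card Fq ^ n ↔
      ∃ C' : Set (Fin n → F), CodeEquiv Fq (C : Set (Fin n → F)) C' ∧
        Nat.card C' = Fintype.card Fq ^ (n * k) ∧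
        (∀ a ∈ C', a ≠ 0 → n - k + 1 ≤ qrank Fq a) ∧
        leftIdealiser Fq C' = scalarCode F n) ∧
    (Nat.card (rightIdealiser Fq (C : Set (Fin n → F))) = Fintype.card Fq ^ n ↔
      ∃ C' : Set (Fin n → F), CodeEquiv Fq (C : Set (Fin n → F)) C' ∧
        Nat.card C' = Fintype.card Fq ^ (n * k) ∧
        (∀ a ∈ C', a ≠ 0 → n - k + 1 ≤ qrank Fq a) ∧
        rightIdealiser Fq C' = scalarCode F n) := by
  have hE : (qEquiv Fq hn '' (C : Set (Fin n → F))) =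
      (C.map (qEquiv Fq hn).toLinearMap : Submodule Fq (Module.End Fq F)) := by
    ext x; simp
  set D : Submodule Fq (Module.End Fq F) := C.map (qEquiv Fq hn).toLinearMap with hDdef
  have hDdim : Module.finrank Fq D = n * k := by
    rw [← hdim]; exact LinearEquiv.finrank_map_eq (qEquiv Fq hn) C
  have hDr : ∀ f ∈ D, f ≠ 0 → n - k + 1 ≤ Module.finrank Fq (LinearMap.range f) := by
    rintro _ ⟨a, ha, rfl⟩ h0
    have := hMRD a ha (by rintro rfl; simp at h0)
    rwa [qrank_eq] at this
  have hCcard : Nat.card (C : Set (Fin n → F)) = Fintype.card Fq ^ (n * k) := by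
    have := Module.natCard_eq_pow_finrank (K := Fq) (V := C)
    rw [hdim, Nat.card_eq_fintype_card (α := Fq)] at this
    exact this
  have hDtop : k = n → D = ⊤ := by
    intro h
    apply Submodule.eq_top_of_finrank_eq
    rw [hDdim, Module.finrank_linearMap, hn, h]
  constructor
  · constructor
    · intro hcard
      rw [card_left_eq Fq hn, hE] at hcard
      have hA : Nat.card (leftAlg Fq D) = Fintype.card Fq ^ Module.finrank Fq F := by
        rw [hn]; exact hcard
      obtain ⟨h, hh⟩ := conj_scalar Fq F (leftAlg Fq D) hA (by
        intro φ hφ h0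
        rcases hkn.lt_or_eq with hlt | heq
        · exact left_inj_of_mrd n k hn hn hk1 hlt D hDdim hDr φ h0 hφ
        · refine inj_of_top Fq (leftAlg Fq D) ?_ hA φ h0
          rw [hDtop heq]
          exact eq_top_iff.mpr fun x _ f _ => trivial)
      obtain ⟨C', h1, h2, h3, h4⟩ := exists_code Fq hn _ _ (C : Set (Fin n → F)) hCcard hMRD h⁻¹ 1
      refine ⟨C', h1, h2, h3, ?_⟩
      ext φ
      rw [mem_scalarCode_iff Fq hn, ← hh, mem_left_iff Fq hn, h4, hE, Set.forall_mem_image]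
      refine forall₂_congr fun f hf => ?_
      constructor
      · rintro ⟨g, hg, hgg⟩
        simp only [Units.val_one, mul_one] at hgg
        rw [mul_assoc, mul_assoc, ← hgg, Units.mul_inv_cancel_left]
        exact hg
      · intro hg
        exact ⟨_, hg, by simp [mul_assoc]⟩
    · rintro ⟨C', h1, -, -, h4⟩
      obtain ⟨s, u, v, huv⟩ := codeEquiv_image Fq hn h1
      rw [card_left_eq Fq hn, ← card_left_conj _ s u v, ← huv, ← card_left_eq Fq hn, h4,
        card_scalarCode Fq hn]
  · constructor
    · intro hcard
      rw [card_right_eq Fq hn, hE] at hcard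
      have hA : Nat.card (rightAlg Fq D) = Fintype.card Fq ^ Module.finrank Fq F := by
        rw [hn]; exact hcard
      obtain ⟨h, hh⟩ := conj_scalar Fq F (rightAlg Fq D) hA (by
        intro φ hφ h0
        rcases hkn.lt_or_eq with hlt | heq
        · exact right_inj_of_mrd n k hn hn hk1 hlt D hDdim hDr φ h0 hφ
        · refine inj_of_top Fq (rightAlg Fq D) ?_ hA φ h0
          rw [hDtop heq]
          exact eq_top_iff.mpr fun x _ f _ => trivial)
      obtain ⟨C', h1, h2, h3, h4⟩ := exists_code Fq hn _ _ (C : Set (Fin n → F)) hCcard hMRD 1 h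
      refine ⟨C', h1, h2, h3, ?_⟩
      ext φ
      rw [mem_scalarCode_iff Fq hn, ← hh, mem_right_iff Fq hn, h4, hE, Set.forall_mem_image]
      refine forall₂_congr fun f hf => ?_
      constructor
      · rintro ⟨g, hg, hgg⟩
        simp only [Units.val_one, one_mul] at hgg
        rw [← mul_assoc, ← mul_assoc, ← hgg, Units.mul_inv_cancel_right]
        exact hg
      · intro hg
        exact ⟨_, hg, by simp [mul_assoc]⟩
    · rintro ⟨C', h1, -, -, h4⟩
      obtain ⟨s, u, v, huv⟩ := codeEquiv_image Fq hn h1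
      rw [card_right_eq Fq hn, ← card_right_conj _ s u v, ← huv, ← card_right_eq Fq hn, h4,
        card_scalarCode Fq hn]
end

section
/- Let n, s, k be positive integers with gcd(s,n) = 1 and k ≤ n−1. Then the generalized Gabidulin code G_{k,s} = ⟨x, x^{q^s}, …, x^{q^{s(k−1)}}⟩_{F_{q^n}} is an F_q-linear MRD code with parameters (n,n,q;n−k+1); equivalently, every nonzero q-polynomial of the form a_0 x + a_1 x^{q^s} + ⋯ + a_{k−1} x^{q^{s(k−1)}} with a_i ∈ F_{q^n} has rank at least n−k+1 as an F_q-linear map of F_{q^n}. -/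
section GabHelpers

variable {K F : Type*} [Field K] [Field F] [Algebra K F]

/-- The operator `∑ i < k, c i * σ^i`. -/
def gabL (σ : F →ₐ[K] F) (k : ℕ) (c : ℕ → F) : F →ₗ[K] F :=
  ∑ i ∈ Finset.range k, (LinearMap.mulLeft K (c i)).comp (σ ^ i).toLinearMap

lemma gabL_apply (σ : F →ₐ[K] F) (k : ℕ) (c : ℕ → F) (x : F) :
    gabL σ k c x = ∑ i ∈ Finset.range k, c i * (σ ^ i) x := by
  simp [gabL]

lemma gab_abel (c z : ℕ → F) (m : ℕ) :
    ∑ i ∈ Finset.range (m + 1), c i * z i =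
      ∑ i ∈ Finset.range m, (-∑ j ∈ Finset.range (i + 1), c j) * (z (i + 1) - z i) +
      (∑ j ∈ Finset.range (m + 1), c j) * z m := by
  induction m with
  | zero => simp
  | succ m ih =>
    rw [Finset.sum_range_succ, ih, Finset.sum_range_succ (fun i => (-∑ j ∈ Finset.range (i + 1), c j) * (z (i + 1) - z i)) m,
      Finset.sum_range_succ c (m + 1)]
    ring

lemma gab_ker_comp [FiniteDimensional K F] (h d : F →ₗ[K] F) :
    Module.finrank K (LinearMap.ker (h.comp d)) ≤
      Module.finrank K (LinearMap.ker h) + Module.finrank K (LinearMap.ker d) := by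
  let r := d.domRestrict (LinearMap.ker (h.comp d))
  have h1 := r.finrank_range_add_finrank_ker
  have h2 : Module.finrank K (LinearMap.range r) ≤ Module.finrank K (LinearMap.ker h) := by
    apply Submodule.finrank_mono
    rintro _ ⟨⟨x, hx⟩, rfl⟩
    simpa [r] using hx
  have h3 : Module.finrank K (LinearMap.ker r) ≤ Module.finrank K (LinearMap.ker d) := by
    let e : LinearMap.ker r →ₗ[K] LinearMap.ker d :=
      LinearMap.codRestrict _ ((LinearMap.ker (h.comp d)).subtype.comp (LinearMap.ker r).subtype)
        (fun x => x.2)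
    apply LinearMap.finrank_le_finrank_of_injective (f := e)
    intro x y hxy
    have : ((x : LinearMap.ker (h.comp d)) : F) = ((y : LinearMap.ker (h.comp d)) : F) :=
      congrArg (fun w : LinearMap.ker d => (w : F)) hxy
    exact Subtype.ext (Subtype.ext this)
  omega

lemma gab_main [FiniteDimensional K F] (σ : F →ₐ[K] F)
    (hσ : ∀ x, σ x = x → x ∈ Set.range (algebraMap K F)) (k : ℕ) :
    ∀ c : ℕ → F, (∃ i < k, c i ≠ 0) →
      Module.finrank K (LinearMap.ker (gabL σ k c)) + 1 ≤ k := by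
  induction k with
  | zero => rintro c ⟨i, hi, _⟩; omega
  | succ k ih =>
    rintro c ⟨i₀, hi₀, hc⟩
    by_cases hb : LinearMap.ker (gabL σ (k + 1) c) = ⊥
    · rw [hb]; simp
    obtain ⟨u, hu, hu0⟩ := (Submodule.ne_bot_iff _).1 hb
    rw [LinearMap.mem_ker, gabL_apply] at hu
    let c' : ℕ → F := fun i => c i * (σ ^ i) u
    let h : ℕ → F := fun i => -∑ j ∈ Finset.range (i + 1), c' j
    let d : F →ₗ[K] F := σ.toLinearMap - LinearMap.id
    have hhk : ∑ j ∈ Finset.range (k + 1), c' j = 0 := hu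
    have hcomp : ∀ y, gabL σ (k + 1) c (u * y) = gabL σ k h (d y) := by
      intro y
      have := gab_abel c' (fun i => (σ ^ i) y) k
      rw [hhk, zero_mul, add_zero] at this
      rw [gabL_apply, gabL_apply]
      simp only [d, LinearMap.sub_apply, LinearMap.id_apply, map_sub, map_mul]
      simpa [c', h, mul_assoc, pow_succ] using this
    have hne : ∃ i < k, h i ≠ 0 := by
      by_contra! hcon
      have hz : ∀ i ≤ k, ∑ j ∈ Finset.range (i + 1), c' j = 0 := by
        intro i hi
        rcases hi.lt_or_eq with h1 | rfl
        · simpa [h] using hcon i h1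
        · exact hhk
      have hz' : c' i₀ = 0 := by
        have h1 := hz i₀ (by omega)
        rw [Finset.sum_range_succ] at h1
        cases i₀ with
        | zero => simpa using h1
        | succ m => rwa [hz m (by omega), zero_add] at h1
      have : (σ ^ i₀) u ≠ 0 := by
        exact (map_ne_zero_iff (σ ^ i₀) (σ ^ i₀).toRingHom.injective).2 hu0
      exact mul_ne_zero hc this hz'
    have h1 := ih h hne
    have h2 := gab_ker_comp (gabL σ k h) d
    have h3 : Module.finrank K (LinearMap.ker d) ≤ 1 := by
      calc _ ≤ Module.finrank K (Submodule.span K {(1 : F)}) := by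
            apply Submodule.finrank_mono
            intro x hx
            obtain ⟨a, rfl⟩ := hσ x (by simpa [d, sub_eq_zero] using hx)
            rw [Submodule.mem_span_singleton]
            exact ⟨a, (Algebra.algebraMap_eq_smul_one a).symm⟩
        _ ≤ 1 := by
            rw [finrank_span_singleton one_ne_zero]
    have h4 : Module.finrank K (LinearMap.ker (gabL σ (k + 1) c)) ≤
        Module.finrank K (LinearMap.ker ((gabL σ k h).comp d)) := by
      let e : LinearMap.ker (gabL σ (k + 1) c) →ₗ[K] LinearMap.ker ((gabL σ k h).comp d) :=
        LinearMap.codRestrict _ ((LinearMap.mulLeft K u⁻¹).comp (Submodule.subtype _))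
          (by
            rintro ⟨x, hx⟩
            rw [LinearMap.mem_ker] at hx ⊢
            rw [LinearMap.comp_apply, ← hcomp]
            simpa [hu0] using hx)
      apply LinearMap.finrank_le_finrank_of_injective (f := e)
      intro x y hxy
      have : u⁻¹ * (x : F) = u⁻¹ * (y : F) := congrArg Subtype.val hxy
      exact Subtype.ext (mul_left_cancel₀ (inv_ne_zero hu0) this)
    omega

lemma gab_fixed [Fintype K] [Fintype F] (n s : ℕ) (hn : Module.finrank K F = n)
    (hgcd : Nat.gcd s n = 1) (x : F) (hx : x ^ Fintype.card K ^ s = x) :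
    x ∈ Set.range (algebraMap K F) := by
  let φ : F → F := fun x => x ^ Fintype.card K
  have hit : ∀ m, φ^[m] x = x ^ Fintype.card K ^ m := fun m => by
    simp only [φ, pow_iterate]
  have h1 : Function.IsPeriodicPt φ s x := by
    change φ^[s] x = x; rw [hit, hx]
  have h2 : Function.IsPeriodicPt φ n x := by
    change φ^[n] x = x
    rw [hit, ← hn, ← Module.card_eq_pow_finrank, FiniteField.pow_card]
  have h3 := h1.gcd h2
  rw [hgcd] at h3
  rw [IsGalois.mem_range_algebraMap_iff_fixed]
  intro f
  obtain ⟨m, rfl⟩ := (FiniteField.bijective_frobeniusAlgEquivOfAlgebraic_pow K F).2 f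
  have h4 : φ^[m] x = x := (Function.IsFixedPt.iterate (f := φ) (x := x) h3 m)
  simp only [AlgEquiv.coe_pow, FiniteField.coe_frobeniusAlgEquivOfAlgebraic_iterate]
  rw [← hit]; exact h4

end GabHelpers

/-- Delsarte, Gabidulin, Kshevetskiy–Gabidulin: the generalized
Gabidulin code `G_{k,s}` is an `Fq`-linear MRD code with parameters `(n,n,q;n−k+1)`:
it has `q^{nk}` elements and every nonzero element has rank at least `n−k+1`. -/
theorem gabidulin_is_MRD
    (Fq F : Type*) [Field Fq] [Fintype Fq] [Field F] [Fintype F] [Algebra Fq F]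
    (n s k : ℕ) (hn : Module.finrank Fq F = n)
    (hn0 : 0 < n) (hs : 0 < s) (hk1 : 0 < k)
    (hgcd : Nat.gcd s n = 1) (hkn : k ≤ n - 1) :
    Nat.card (Gcode F n s k) = Fintype.card Fq ^ (n * k) ∧
    (∀ a ∈ Gcode F n s k, a ≠ 0 → n - k + 1 ≤ qrank Fq a) := by
  classical
  have hcardF : Fintype.card F = Fintype.card Fq ^ n := by
    rw [← hn]; exact Module.card_eq_pow_finrank
  constructor
  · have hinj : Function.Injective (fun (c : Fin k → F) => fun j : Fin n =>
        ∑ i : Fin k, if (j : ℕ) = (s * (i : ℕ)) % n then c i else 0) := by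
      intro c c' hcc
      funext i₀
      have h1 := congrFun hcc ⟨(s * (i₀ : ℕ)) % n, Nat.mod_lt _ hn0⟩
      have hiff : ∀ i : Fin k, (s * (i₀ : ℕ)) % n = (s * (i : ℕ)) % n ↔ i₀ = i := by
        intro i
        constructor
        · intro h
          have h2 : (i₀ : ℕ) ≡ i [MOD n] :=
            Nat.ModEq.cancel_left_of_coprime (by rw [Nat.gcd_comm]; exact hgcd) h
          exact Fin.ext (Nat.ModEq.eq_of_lt_of_lt h2 (by omega) (by omega))
        · rintro rfl; rfl
      simpa [hiff] using h1
    have hG : Gcode F n s k = Set.range (fun (c : Fin k → F) => fun j : Fin n =>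
        ∑ i : Fin k, if (j : ℕ) = (s * (i : ℕ)) % n then c i else 0) := by
      ext a; simp only [Gcode, Set.mem_ofPred_eq, Set.mem_range, eq_comm]
    rw [hG, Nat.card_range_of_injective hinj]
    simp [hcardF, pow_mul]
  · rintro a ⟨c, rfl⟩ ha
    let σ : F →ₐ[Fq] F := (FiniteField.frobeniusAlgHom Fq F) ^ s
    have hσ : ∀ i x, (σ ^ i) x = x ^ Fintype.card Fq ^ (s * i) := by
      intro i x
      simp only [σ, ← pow_mul, AlgHom.coe_pow, FiniteField.coe_frobeniusAlgHom, pow_iterate]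
    let c' : ℕ → F := fun i => if h : i < k then c ⟨i, h⟩ else 0
    have hmod : ∀ (x : F) (m : ℕ), x ^ Fintype.card Fq ^ (m % n) = x ^ Fintype.card Fq ^ m := by
      intro x m
      conv_rhs => rw [← Nat.mod_add_div m n, pow_add, pow_mul, pow_mul, ← hcardF,
        FiniteField.pow_card_pow]
    have hev : qeval Fq (fun j : Fin n =>
        ∑ i : Fin k, if (j : ℕ) = (s * (i : ℕ)) % n then c i else 0) = gabL σ k c' := by
      funext x
      rw [gabL_apply, Finset.sum_range]
      simp only [qeval, Finset.sum_mul]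
      rw [Finset.sum_comm]
      refine Finset.sum_congr rfl fun i _ => ?_
      rw [Finset.sum_eq_single (⟨(s * (i : ℕ)) % n, Nat.mod_lt _ hn0⟩ : Fin n)]
      · simp [hmod, hσ, c']
      · intro j _ hj
        rw [if_neg (fun h => hj (Fin.ext h)), zero_mul]
      · simp
    have hne : ∃ i < k, c' i ≠ 0 := by
      by_contra! hcon
      apply ha
      have : ∀ i, c i = 0 := fun i => by simpa [c'] using hcon i i.2
      funext j; simp [this]
    have hfix : ∀ x, σ x = x → x ∈ Set.range (algebraMap Fq F) := by
      intro x hx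
      apply gab_fixed n s hn hgcd
      have := hσ 1 x
      rw [pow_one, mul_one] at this
      rw [← this, hx]
    have h1 := gab_main σ hfix k c' hne
    have h2 := (gabL σ k c').finrank_range_add_finrank_ker
    have h3 : qrank Fq (fun j : Fin n =>
        ∑ i : Fin k, if (j : ℕ) = (s * (i : ℕ)) % n then c i else 0) =
        Module.finrank Fq (LinearMap.range (gabL σ k c')) := by
      rw [qrank, hev, ← LinearMap.coe_range, Submodule.span_eq]
    rw [h3]
    omega
end

section
/- Let gcd(s,n) = 1 and 1 ≤ k ≤ n−1. The Delsarte dual of the generalized Gabidulin code G_{k,s} is equivalent to G_{n−k,s}, and the adjoint code G_{k,s}^⊤ is equivalent to G_{k,s} itself. -/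
section Aux

/-- vectors supported on `S` -/
def suppCode (F : Type*) [Field F] {n : ℕ} (S : Set (Fin n)) : Set (Fin n → F) :=
  {a | ∀ j, j ∉ S → a j = 0}

/-- support of the Gabidulin code -/
def gS (n s k : ℕ) : Set (Fin n) := {j | ∃ i < k, (j : ℕ) = (s * i) % n}

lemma gS_inj {n s : ℕ} (hg : Nat.gcd s n = 1) {i i' : ℕ}
    (h : (s * i) % n = (s * i') % n) : i ≡ i' [MOD n] := by
  have h' : s * i ≡ s * i' [MOD n] := h
  exact Nat.ModEq.cancel_left_of_coprime (by rw [Nat.gcd_comm]; exact hg) h'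

lemma gS_surj {n s : ℕ} (hg : Nat.gcd s n = 1) (j : Fin n) :
    ∃ i < n, (j : ℕ) = (s * i) % n := by
  have hinj : Function.Injective (fun i : Fin n => (⟨(s * i) % n, Nat.mod_lt _ j.pos⟩ : Fin n)) := by
    intro a b hab
    have h1 := gS_inj hg (Fin.mk.inj_iff.mp hab)
    exact Fin.ext (Nat.ModEq.eq_of_lt_of_lt h1 a.2 b.2)
  obtain ⟨i, hi⟩ := (Finite.injective_iff_surjective.mp hinj) j
  exact ⟨i, i.2, (congrArg Fin.val hi).symm⟩

lemma mem_gS_iff {n s k : ℕ} (hg : Nat.gcd s n = 1) (hk : k ≤ n) (j : Fin n) (i : ℕ)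
    (hj : (j : ℕ) = (s * i) % n) : j ∈ gS n s k ↔ i % n < k := by
  constructor
  · rintro ⟨i', hi', h⟩
    have h1 : i % n = i' % n := gS_inj hg (hj.symm.trans h)
    rw [h1, Nat.mod_eq_of_lt (by omega)]
    exact hi'
  · intro h
    exact ⟨i % n, h, by rw [hj, Nat.mul_mod_mod]⟩

lemma Gcode_eq {F : Type*} [Field F] {n s k : ℕ} (hg : Nat.gcd s n = 1) (hk : k ≤ n) :
    Gcode F n s k = suppCode F (gS n s k) := by
  ext a
  constructor
  · rintro ⟨c, rfl⟩ j hj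
    apply Finset.sum_eq_zero
    intro i _
    rw [if_neg]
    intro h
    exact hj ⟨i, i.2, h⟩
  · intro ha
    by_cases hn : n = 0
    · subst hn
      exact ⟨fun _ => 0, funext fun j => j.elim0⟩
    have hpos : 0 < n := Nat.pos_of_ne_zero hn
    refine ⟨fun i => a ⟨(s * i) % n, Nat.mod_lt _ hpos⟩, ?_⟩
    funext j
    by_cases hj : j ∈ gS n s k
    · obtain ⟨i, hi, h⟩ := hj
      rw [Finset.sum_eq_single (⟨i, hi⟩ : Fin k)]
      · rw [if_pos h]
        congr 1
        exact Fin.ext h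
      · intro b _ hb
        rw [if_neg]
        intro h'
        apply hb
        apply Fin.ext
        exact Nat.ModEq.eq_of_lt_of_lt (gS_inj hg (h'.symm.trans h)) (by omega) (by simp; omega)
      · simp
    · rw [ha j hj, Finset.sum_eq_zero]
      intro i _
      rw [if_neg]
      intro h
      exact hj ⟨i, i.2, h⟩

variable (Fq : Type*) [Field Fq] [Fintype Fq] {F : Type*} [Field F] [Fintype F]

lemma qperp_supp [Algebra Fq F] {n : ℕ} (S : Set (Fin n)) :
    qperp Fq (suppCode F S) = suppCode F Sᶜ := by
  ext a
  constructor
  · intro ha j hj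
    have hj : j ∈ S := by simpa using hj
    have hnd := traceForm_nondegenerate Fq F
    apply hnd.1
    intro c
    have := ha (Pi.single j c) (fun i hi => by
      rw [Pi.single_eq_of_ne]; rintro rfl; exact hi hj)
    rw [Finset.sum_eq_single j] at this
    · simpa [Algebra.traceForm_apply] using this
    · intro b _ hb; rw [Pi.single_eq_of_ne hb, mul_zero]
    · simp
  · intro ha b hb
    rw [Finset.sum_eq_zero, map_zero]
    intro i _
    by_cases hi : i ∈ S
    · rw [ha i (by simpa using hi), zero_mul]
    · rw [hb i hi, mul_zero]

lemma pow_surj [Algebra Fq F] {n : ℕ} (hn : Module.finrank Fq F = n) (m : ℕ) (hm : m ≤ n) (x : F) :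
    (x ^ (Fintype.card Fq) ^ (n - m)) ^ (Fintype.card Fq) ^ m = x := by
  rw [← pow_mul, ← pow_add, Nat.sub_add_cancel hm, ← hn, ← Module.card_eq_pow_finrank,
    FiniteField.pow_card]

lemma qadjoint_supp [Algebra Fq F] {n : ℕ} [NeZero n] (hn : Module.finrank Fq F = n)
    (S : Set (Fin n)) :
    qadjoint Fq '' (suppCode F S) = suppCode F {j | -j ∈ S} := by
  have key : ∀ j : Fin n, (⟨(n - (j : ℕ)) % n, Nat.mod_lt _ j.pos⟩ : Fin n) = -j := by
    intro j; apply Fin.ext; rw [Fin.val_neg']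
  have hq : Fintype.card Fq ≠ 0 := Fintype.card_ne_zero
  ext b
  constructor
  · rintro ⟨a, ha, rfl⟩ j hj
    simp only [qadjoint, key]
    rw [ha _ hj, zero_pow (pow_ne_zero _ hq)]
  · intro hb
    refine ⟨fun j => (b (-j)) ^ (Fintype.card Fq) ^ (n - ((-j : Fin n) : ℕ)), ?_, ?_⟩
    · intro j hj
      have : b (-j) = 0 := hb _ (by simpa using hj)
      simp only [this]
      rw [zero_pow (pow_ne_zero _ hq)]
    · funext j
      simp only [qadjoint, key, neg_neg]
      exact pow_surj Fq hn _ j.2.le _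

lemma qeval_single_bij [Algebra Fq F] {n : ℕ} (hn : Module.finrank Fq F = n) (m : Fin n) :
    Function.Bijective (qeval Fq (Pi.single m (1 : F))) := by
  have h : qeval Fq (Pi.single m (1 : F)) = fun x => x ^ (Fintype.card Fq) ^ (m : ℕ) := by
    funext x
    rw [qeval, Finset.sum_eq_single m]
    · simp
    · intro b _ hb; rw [Pi.single_eq_of_ne hb, zero_mul]
    · simp
  rw [h]
  exact (Finite.surjective_iff_bijective).mp fun x => ⟨_, pow_surj Fq hn m m.2.le x⟩

lemma qcomp_shift {n : ℕ} [NeZero n] (m : Fin n) (a : Fin n → F) :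
    qcomp Fq (Pi.single 0 1) (qcomp Fq a (Pi.single m 1)) = fun j => a (j - m) := by
  have hq : Fintype.card Fq ≠ 0 := Fintype.card_ne_zero
  funext j
  rw [qcomp, Finset.sum_eq_single 0]
  · simp only [Pi.single_eq_same, one_mul, Fin.val_zero, pow_zero, pow_one, sub_zero]
    rw [qcomp, Finset.sum_eq_single (j - m)]
    · rw [sub_sub_cancel, Pi.single_eq_same, one_pow, mul_one]
    · intro b _ hb
      rw [Pi.single_eq_of_ne, zero_pow (pow_ne_zero _ hq), mul_zero]
      rintro rfl
      exact hb (by rw [sub_sub_cancel])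
    · simp
  · intro b _ hb; rw [Pi.single_eq_of_ne hb, zero_mul]
  · simp

lemma equiv_supp [Algebra Fq F] {n : ℕ} [NeZero n] (hn : Module.finrank Fq F = n) (m : Fin n)
    (S S' : Set (Fin n)) (h : ∀ j, j ∈ S' ↔ j - m ∈ S) :
    CodeEquiv Fq (suppCode F S) (suppCode F S') := by
  refine ⟨Pi.single 0 1, Pi.single m 1, RingEquiv.refl F, qeval_single_bij Fq hn 0,
    qeval_single_bij Fq hn m, ?_⟩
  ext b
  constructor
  · intro hb
    refine ⟨fun j => b (j + m), ?_, ?_⟩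
    · intro j hj
      apply hb
      rw [h, add_sub_cancel_right]
      exact hj
    · simp only [RingEquiv.refl_apply]
      rw [qcomp_shift]
      funext j
      rw [sub_add_cancel]
  · rintro ⟨a, ha, rfl⟩
    simp only [RingEquiv.refl_apply]
    rw [qcomp_shift]
    intro j hj
    exact ha _ (fun h' => hj ((h j).2 h'))

end Aux

theorem gabidulin_dual_and_adjoint
    (Fq F : Type*) [Field Fq] [Fintype Fq] [Field F] [Fintype F] [Algebra Fq F]
    (n s k : ℕ) (hn : Module.finrank Fq F = n)
    (hgcd : Nat.gcd s n = 1) (hk1 : 1 ≤ k) (hkn : k ≤ n - 1) :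
    CodeEquiv Fq (qperp Fq (Gcode F n s k)) (Gcode F n s (n - k)) ∧
    CodeEquiv Fq (qadjoint Fq '' Gcode F n s k) (Gcode F n s k) := by
  haveI : NeZero n := ⟨by omega⟩
  rw [Gcode_eq hgcd (by omega : k ≤ n), Gcode_eq hgcd (by omega : n - k ≤ n), qperp_supp,
    qadjoint_supp Fq hn]
  constructor
  · apply equiv_supp Fq hn (-(Fin.ofNat n (s * k)))
    intro j
    obtain ⟨i, hi, hj⟩ := gS_surj hgcd j
    have h2 : ((j - -(Fin.ofNat n (s * k)) : Fin n) : ℕ) = (s * (i + k)) % n := by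
      rw [sub_neg_eq_add, Fin.val_add, hj, Fin.val_ofNat, ← Nat.add_mod, mul_add]
    rw [Set.mem_compl_iff, mem_gS_iff hgcd (by omega) j i hj, mem_gS_iff hgcd (by omega) _ _ h2,
      Nat.mod_eq_of_lt hi]
    by_cases hik : i + k < n
    · rw [Nat.mod_eq_of_lt hik]; omega
    · rw [Nat.mod_eq_sub_mod (by omega), Nat.mod_eq_of_lt (by omega)]; omega
  · apply equiv_supp Fq hn (Fin.ofNat n (s * (k - 1)))
    intro j
    obtain ⟨i, hi, hj⟩ := gS_surj hgcd j
    have h2 : ((-(j - (Fin.ofNat n (s * (k - 1)))) : Fin n) : ℕ) = (s * (k - 1 + (n - i))) % n := by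
      have hj' : j = Fin.ofNat n (s * i) := Fin.ext hj
      have : -(j - (Fin.ofNat n (s * (k - 1)))) = Fin.ofNat n (s * (k - 1 + (n - i))) := by
        rw [neg_sub, sub_eq_iff_eq_add, hj']
        apply Fin.ext
        rw [Fin.val_add, Fin.val_ofNat, Fin.val_ofNat, Fin.val_ofNat, ← Nat.add_mod, ← mul_add,
          show k - 1 + (n - i) + i = k - 1 + n by omega, mul_add, Nat.add_mul_mod_self_right]
      rw [this, Fin.val_ofNat]
    rw [Set.mem_setOf_eq, mem_gS_iff hgcd (by omega) j i hj, mem_gS_iff hgcd (by omega) _ _ h2,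
      Nat.mod_eq_of_lt hi]
    by_cases hik : k - 1 + (n - i) < n
    · rw [Nat.mod_eq_of_lt hik]; omega
    · rw [Nat.mod_eq_sub_mod (by omega), Nat.mod_eq_of_lt (by omega)]; omega
end

section
/- The left and right idealisers of the generalized Gabidulin code G_{k,s} (with gcd(s,n)=1, 1 ≤ k ≤ n−1) are both isomorphic to the field F_{q^n}: L(G_{k,s}) = R(G_{k,s}) = {x ↦ αx : α ∈ F_{q^n}}. -/
theorem gi_inj {n s a b : ℕ} (hgcd : Nat.gcd s n = 1) (ha : a < n) (hb : b < n)
    (h : (s * a) % n = (s * b) % n) : a = b := by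
  have h1 : s * a ≡ s * b [MOD n] := h
  have h2 : a ≡ b [MOD n] :=
    Nat.ModEq.cancel_left_of_coprime (by rw [Nat.gcd_comm]; exact hgcd) h1
  exact Nat.ModEq.eq_of_lt_of_lt h2 ha hb

theorem gi_comb {n s k t : ℕ} (hgcd : Nat.gcd s n = 1) (hk1 : 1 ≤ k) (hkn : k ≤ n - 1)
    (ht : t < n) (h : ∀ i < k, ∃ i' < k, (t + (s * i) % n) % n = (s * i') % n) : t = 0 := by
  obtain ⟨u, -, hu⟩ := Nat.exists_mul_mod_eq_one_of_coprime (n := s) (k := n) hgcd (by omega)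
  have hm : (s * ((u * t) % n)) % n = t := by
    have h1 : s * u ≡ 1 [MOD n] := by
      unfold Nat.ModEq
      rw [hu, Nat.mod_eq_of_lt (by omega)]
    have h2 : s * ((u * t) % n) ≡ t [MOD n] := by
      calc s * ((u * t) % n) ≡ s * (u * t) [MOD n] := (Nat.mod_modEq _ _).mul_left _
        _ = (s * u) * t := by ring
        _ ≡ 1 * t [MOD n] := h1.mul_right _
        _ = t := one_mul t
    unfold Nat.ModEq at h2
    rw [h2, Nat.mod_eq_of_lt ht]
  have hmn : (u * t) % n < n := Nat.mod_lt _ (by omega)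
  generalize (u * t) % n = m at hm hmn
  rcases Nat.eq_zero_or_pos m with h0 | h0
  · subst h0; simpa using hm.symm
  exfalso
  have key : ∃ i < k, k ≤ m + i ∧ m + i < n := by
    by_cases hmk : m < k
    · exact ⟨k - m, by omega, by omega, by omega⟩
    · exact ⟨0, by omega, by omega, by omega⟩
  obtain ⟨i, hi, h1, h2⟩ := key
  obtain ⟨i', hi', h3⟩ := h i hi
  rw [← hm, ← Nat.add_mod, ← mul_add] at h3
  have := gi_inj hgcd h2 (by omega) h3
  omega

theorem gi_mem {F : Type*} [Field F] [Fintype F] {n s k : ℕ} (hgcd : Nat.gcd s n = 1)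
    (hk1 : 1 ≤ k) (hkn : k ≤ n - 1) (a : Fin n → F) :
    a ∈ Gcode F n s k ↔ ∀ j, a j ≠ 0 → ∃ i < k, (j : ℕ) = (s * i) % n := by
  constructor
  · rintro ⟨c, rfl⟩ j hj
    obtain ⟨i, -, hi⟩ := Finset.exists_ne_zero_of_sum_ne_zero hj
    refine ⟨i, i.2, ?_⟩
    by_contra hne
    exact hi (if_neg hne)
  · intro h
    refine ⟨fun i => a ⟨(s * (i : ℕ)) % n, Nat.mod_lt _ (by omega)⟩, ?_⟩
    funext j
    by_cases hj : ∃ i < k, (j : ℕ) = (s * i) % n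
    · obtain ⟨i, hi, hji⟩ := hj
      rw [Finset.sum_eq_single (⟨i, hi⟩ : Fin k)]
      · rw [if_pos hji]
        congr 1
        exact Fin.ext hji
      · intro b _ hb
        apply if_neg
        intro hjb
        apply hb
        have hb2 := b.2
        exact Fin.ext (gi_inj hgcd (by omega) (by omega) (hjb.symm.trans hji))
      · intro h'; exact absurd (Finset.mem_univ _) h'
    · rw [Finset.sum_eq_zero]
      · by_contra hne
        exact hj (h j hne)
      · intro b _
        apply if_neg
        intro hjb
        exact hj ⟨b, b.2, hjb⟩

theorem gi_single {F : Type*} [Field F] [Fintype F] {n s k : ℕ} (hgcd : Nat.gcd s n = 1)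
    (hk1 : 1 ≤ k) (hkn : k ≤ n - 1) (j : Fin n) (hj : ∃ i < k, (j : ℕ) = (s * i) % n) :
    (Pi.single j 1 : Fin n → F) ∈ Gcode F n s k := by
  rw [gi_mem hgcd hk1 hkn]
  intro l hl
  by_cases h : l = j
  · subst h; exact hj
  · exact absurd (Pi.single_eq_of_ne h _) hl

theorem gi_scalar {F : Type*} [Field F] [Fintype F] {n s k : ℕ} (hgcd : Nat.gcd s n = 1)
    (hk1 : 1 ≤ k) (hkn : k ≤ n - 1) (φ : Fin n → F)
    (h : ∀ t, φ t ≠ 0 → ∀ j : Fin n, (∃ i < k, (j : ℕ) = (s * i) % n) →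
      ∃ i < k, ((t + j : Fin n) : ℕ) = (s * i) % n) : φ ∈ scalarCode F n := by
  have hn : 0 < n := by omega
  refine ⟨φ ⟨0, hn⟩, ?_⟩
  funext t
  show (if (t : ℕ) = 0 then φ ⟨0, hn⟩ else 0) = φ t
  split_ifs with ht
  · congr 1; exact Fin.ext ht.symm
  · by_contra hne
    apply ht
    apply gi_comb hgcd hk1 hkn t.2
    intro i hi
    obtain ⟨i', hi', h'⟩ := h t (Ne.symm hne) ⟨(s * i) % n, Nat.mod_lt _ hn⟩ ⟨i, hi, rfl⟩
    exact ⟨i', hi', by rw [← h', Fin.val_add]⟩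

/-- the left and right idealisers of the generalized Gabidulin code
`G_{k,s}` both equal `{x ↦ αx : α ∈ F_{q^n}} ≅ F_{q^n}`. -/
theorem gabidulin_idealisers
    (Fq F : Type*) [Field Fq] [Fintype Fq] [Field F] [Fintype F] [Algebra Fq F]
    (n s k : ℕ) (hn : Module.finrank Fq F = n)
    (hgcd : Nat.gcd s n = 1) (hk1 : 1 ≤ k) (hkn : k ≤ n - 1) :
    leftIdealiser Fq (Gcode F n s k) = scalarCode F n ∧
    rightIdealiser Fq (Gcode F n s k) = scalarCode F n := by
  have hn0 : n ≠ 0 := by omega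
  clear hn
  have : NeZero n := ⟨hn0⟩
  have hq : ∀ i : ℕ, Fintype.card Fq ^ i ≠ 0 := fun i => pow_ne_zero _ Fintype.card_ne_zero
  have hval : ∀ j : Fin n, (j : ℕ) = 0 ↔ j = 0 := fun j => by
    rw [Fin.ext_iff]; simp
  constructor
  · ext φ
    constructor
    · intro hφ
      apply gi_scalar hgcd hk1 hkn
      intro t ht j hj
      have h1 := (gi_mem hgcd hk1 hkn _).1 (hφ _ (gi_single hgcd hk1 hkn j hj))
      apply h1
      unfold qcomp
      rw [Finset.sum_eq_single t]
      · simpa using ht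
      · intro b _ hb
        rw [Pi.single_eq_of_ne, zero_pow (hq _), mul_zero]
        intro h
        apply hb
        have h2 : t + j = j + b := sub_eq_iff_eq_add.1 h
        rw [add_comm j b] at h2
        exact (add_right_cancel h2).symm
      · simp
    · rintro ⟨α, rfl⟩ f hf
      rw [gi_mem hgcd hk1 hkn] at hf ⊢
      intro j hj
      apply hf
      intro h0
      apply hj
      unfold qcomp
      apply Finset.sum_eq_zero
      intro i _
      by_cases hi : i = 0
      · subst hi; simp [h0]
      · simp [hval, hi]
  · ext φ
    constructor
    · intro hφ
      apply gi_scalar hgcd hk1 hkn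
      intro t ht j hj
      have h1 := (gi_mem hgcd hk1 hkn _).1 (hφ _ (gi_single hgcd hk1 hkn j hj))
      apply h1
      unfold qcomp
      rw [Finset.sum_eq_single j]
      · simp [ht]
      · intro b _ hb
        rw [Pi.single_eq_of_ne hb, zero_mul]
      · simp
    · rintro ⟨α, rfl⟩ f hf
      rw [gi_mem hgcd hk1 hkn] at hf ⊢
      intro j hj
      apply hf
      intro h0
      apply hj
      unfold qcomp
      apply Finset.sum_eq_zero
      intro i _
      by_cases hi : i = j
      · subst hi; simp [h0]
      · have : ¬ (j - i = 0) := fun h => hi (sub_eq_zero.1 h).symm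
        simp only [hval, this, if_false]
        rw [zero_pow (hq _), mul_zero]
end

section
/- Let n, s, k, h be integers with gcd(s,n) = 1, 1 ≤ k ≤ n−1, and let η ∈ F_{q^n} satisfy N_{q^n/q}(η) ≠ (−1)^{nk}. Then the generalized twisted Gabidulin code H_{k,s}(η,h) = {a_0 x + a_1 x^{q^s} + ⋯ + a_{k−1} x^{q^{s(k−1)}} + a_0^{q^h} η x^{q^{sk}} : a_i ∈ F_{q^n}} is an F_q-linear MRD code of dimension nk with parameters (n,n,q;n−k+1). -/
section Helper

/-- The skew polynomial map `∑_{i ≤ k} c i σ^i`. -/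
noncomputable def twL {K F : Type*} [Field K] [Field F] [Algebra K F] (σ : F ≃ₐ[K] F)
    (k : ℕ) (c : ℕ → F) : F →ₗ[K] F :=
  ∑ i ∈ Finset.range (k + 1), c i • ((σ ^ i : F ≃ₐ[K] F).toLinearMap)

theorem twL_apply {K F : Type*} [Field K] [Field F] [Algebra K F] (σ : F ≃ₐ[K] F)
    (k : ℕ) (c : ℕ → F) (x : F) :
    twL σ k c x = ∑ i ∈ Finset.range (k + 1), c i * (σ ^ i) x := by
  simp [twL, LinearMap.sum_apply]

theorem twL_div {K F : Type*} [Field K] [Field F] [Algebra K F] (σ : F ≃ₐ[K] F) (a : F)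
    (k : ℕ) : ∀ c : ℕ → F, ∃ (b : ℕ → F) (r : F),
      (∀ x, twL σ (k + 1) c x = twL σ k b (σ x - a * x) + r * x) ∧
      b k = c (k + 1) ∧ c 0 = r - b 0 * a ∧
      ((∀ i ≤ k, b i = 0) → r = 0 → ∀ i ≤ k + 1, c i = 0) := by
  induction k with
  | zero =>
    intro c
    refine ⟨fun _ => c 1, c 0 + c 1 * a, ?_, rfl, by ring, ?_⟩
    · intro x
      simp [twL_apply, Finset.sum_range_succ]
      ring
    · intro hb hr i hi
      have h1 := hb 0 le_rfl
      simp only at h1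
      interval_cases i
      · simpa [h1] using hr
      · exact h1
  | succ k ih =>
    intro c
    obtain ⟨b, r, h1, h2, h3, h4⟩ :=
      ih (Function.update c (k + 1) (c (k + 1) + c (k + 2) * (σ ^ (k + 1)) a))
    refine ⟨Function.update b (k + 1) (c (k + 2)), r, ?_, by simp, ?_, ?_⟩
    · intro x
      have e := h1 x
      rw [twL_apply, Finset.sum_range_succ, Finset.sum_congr rfl
        (g := fun i => c i * (σ ^ i) x)] at e
      · have hs : ∑ i ∈ Finset.range (k + 1), Function.update b (k + 1) (c (k + 2)) i *
            (σ ^ i) (σ x - a * x) = ∑ i ∈ Finset.range (k + 1), b i * (σ ^ i) (σ x - a * x) := ?_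
        · rw [twL_apply, Finset.sum_range_succ, Finset.sum_range_succ _ (k + 1), twL_apply,
            Finset.sum_range_succ _ (k + 1), hs, ← twL_apply σ k b]
          simp only [Function.update_self] at e ⊢
          have : (σ ^ (k + 1 + 1)) x = (σ ^ (k + 1)) (σ x) := by
            rw [pow_succ σ (k + 1)]; rfl
          rw [this, map_sub (σ ^ (k + 1)), map_mul (σ ^ (k + 1))]
          linear_combination e
        · refine Finset.sum_congr rfl fun i hi => ?_
          rw [Function.update_of_ne]
          have := Finset.mem_range.1 hi
          omega
      · intro i hi
        rw [Function.update_of_ne]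
        have := Finset.mem_range.1 hi
        omega
    · rw [Function.update_of_ne (by omega)] at h3 ⊢
      exact h3
    · intro hb hr
      have hc2 : c (k + 2) = 0 := by simpa using hb (k + 1) le_rfl
      have := h4 (fun i hi => by
        have := hb i (by omega)
        rwa [Function.update_of_ne (by omega)] at this) hr
      intro i hi
      rcases Nat.lt_or_ge i (k + 1) with h | h
      · have t := this i (by omega)
        rwa [Function.update_of_ne (by omega)] at t
      · rcases Nat.eq_or_lt_of_le h with h | h
        · have t := this i (by omega)
          subst h
          simpa [hc2] using t
        · obtain rfl : i = k + 2 := by omega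
          exact hc2

theorem twL_step {K F : Type*} [Field K] [Field F] [Algebra K F] [FiniteDimensional K F]
    (σ : F ≃ₐ[K] F) (hfix : ∀ x, σ x = x → ∃ y, algebraMap K F y = x)
    (k m : ℕ) (c : ℕ → F) (hm : m + 1 ≤ Module.finrank K (LinearMap.ker (twL σ (k + 1) c))) :
    ∃ (b : ℕ → F) (a : F), Algebra.norm K a = 1 ∧ b k = c (k + 1) ∧ c 0 = - b 0 * a ∧
      ((∀ i ≤ k, b i = 0) → ∀ i ≤ k + 1, c i = 0) ∧
      m ≤ Module.finrank K (LinearMap.ker (twL σ k b)) := by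
  have hpos : 0 < Module.finrank K (LinearMap.ker (twL σ (k + 1) c)) := by omega
  obtain ⟨⟨u, hu⟩, hu0⟩ := (Module.finrank_pos_iff_exists_ne_zero).1 hpos
  have hu0 : u ≠ 0 := fun h => hu0 (Subtype.ext h)
  have huk : twL σ (k + 1) c u = 0 := hu
  obtain ⟨b, r, h1, h2, h3, h4⟩ := twL_div σ (σ u / u) k c
  have hr : r = 0 := by
    have := h1 u
    rw [div_mul_cancel₀ _ hu0, sub_self, map_zero, zero_add, huk] at this
    exact (mul_eq_zero.1 this.symm).resolve_right hu0
  subst hr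
  refine ⟨b, σ u / u, ?_, h2, by rw [h3]; ring, fun h => h4 h rfl, ?_⟩
  · rw [div_eq_mul_inv, map_mul, Algebra.norm_eq_of_algEquiv, ← map_mul,
      mul_inv_cancel₀ hu0, map_one]
  · let d : F →ₗ[K] F := σ.toLinearMap - LinearMap.mulLeft K (σ u / u)
    have hd : ∀ x, d x = σ x - σ u / u * x := fun x => by simp [d]
    let e := d.domRestrict (LinearMap.ker (twL σ (k + 1) c))
    have hrn := LinearMap.finrank_range_add_finrank_ker e
    have hle : Module.finrank K (LinearMap.range e) ≤
        Module.finrank K (LinearMap.ker (twL σ k b)) := by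
      apply Submodule.finrank_mono
      rintro _ ⟨⟨x, hx⟩, rfl⟩
      have hx' : twL σ (k + 1) c x = 0 := hx
      have := h1 x
      rw [hx', zero_mul, add_zero] at this
      change twL σ k b (d x) = 0
      rw [hd, this]
    have hk1 : Module.finrank K (LinearMap.ker e) ≤ 1 := by
      refine finrank_le_one ⟨⟨u, hu⟩, ?_⟩ ?_
      · change d u = 0
        rw [hd, div_mul_cancel₀ _ hu0, sub_self]
      · rintro ⟨⟨x, hx⟩, hx'⟩
        have hx' : d x = 0 := hx'
        rw [hd, sub_eq_zero] at hx'
        have hsu : σ u ≠ 0 := by simpa using hu0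
        obtain ⟨y, hy⟩ := hfix (x / u) (by
          rw [map_div₀, hx']; field_simp)
        refine ⟨y, Subtype.ext (Subtype.ext ?_)⟩
        change y • u = x
        rw [Algebra.smul_def, hy, div_mul_cancel₀ _ hu0]
    omega

theorem twL_zero {K F : Type*} [Field K] [Field F] [Algebra K F] [FiniteDimensional K F]
    (σ : F ≃ₐ[K] F) (hfix : ∀ x, σ x = x → ∃ y, algebraMap K F y = x)
    (k : ℕ) : ∀ (c : ℕ → F), k + 1 ≤ Module.finrank K (LinearMap.ker (twL σ k c)) →
      ∀ i ≤ k, c i = 0 := by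
  induction k with
  | zero =>
    intro c hc i hi
    obtain rfl : i = 0 := by omega
    obtain ⟨⟨u, hu⟩, hu0⟩ := (Module.finrank_pos_iff_exists_ne_zero).1
      (show 0 < Module.finrank K (LinearMap.ker (twL σ 0 c)) by omega)
    have hu0 : u ≠ 0 := fun h => hu0 (Subtype.ext h)
    have huk : twL σ 0 c u = 0 := hu
    rw [twL_apply] at huk
    simpa [hu0] using huk
  | succ k ih =>
    intro c hc
    obtain ⟨b, a, -, -, -, h4, h5⟩ := twL_step σ hfix k (k + 1) c hc
    exact h4 (ih b h5)

theorem twL_norm {K F : Type*} [Field K] [Field F] [Algebra K F] [FiniteDimensional K F]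
    (σ : F ≃ₐ[K] F) (hfix : ∀ x, σ x = x → ∃ y, algebraMap K F y = x)
    (k : ℕ) : ∀ (c : ℕ → F), k ≤ Module.finrank K (LinearMap.ker (twL σ k c)) →
      Algebra.norm K (c 0) = (-1) ^ (Module.finrank K F * k) * Algebra.norm K (c k) := by
  induction k with
  | zero => simp
  | succ k ih =>
    intro c hc
    obtain ⟨b, a, ha, h2, h3, h4, h5⟩ := twL_step σ hfix k k c hc
    have hm1 : Algebra.norm K (-1 : F) = (-1) ^ Module.finrank K F := by
      have := Algebra.norm_algebraMap (S := F) (-1 : K)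
      simpa using this
    rw [h3, ← neg_one_mul (b 0), map_mul, map_mul, ha, ih b h5, h2, hm1]
    ring

theorem frob_fix {K F : Type*} [Field K] [Fintype K] [Field F] [Fintype F] [Algebra K F]
    (s : ℕ) (hs : Nat.gcd s (Module.finrank K F) = 1) (x : F)
    (hx : (FiniteField.frobeniusAlgEquivOfAlgebraic K F ^ s) x = x) :
    ∃ y, algebraMap K F y = x := by
  have key : ∀ (τ : F ≃ₐ[K] F), τ x = x → ∀ m : ℕ, (τ ^ m) x = x := by
    intro τ hτ m
    induction m with
    | zero => simp
    | succ m ih =>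
      rw [pow_succ]
      change (τ ^ m) (τ x) = x
      rw [hτ, ih]
  rw [← FiniteField.orderOf_frobeniusAlgEquivOfAlgebraic K F] at hs
  obtain ⟨m, hm⟩ := exists_pow_eq_self_of_coprime hs
  have h1 : FiniteField.frobeniusAlgEquivOfAlgebraic K F x = x := by
    have := key _ hx m
    rwa [hm] at this
  have hfix : x ∈ (⊥ : IntermediateField K F) := by
    rw [IsGalois.mem_bot_iff_fixed]
    intro f
    obtain ⟨j, rfl⟩ := (FiniteField.bijective_frobeniusAlgEquivOfAlgebraic_pow K F).2 f
    exact key _ h1 j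
  exact IntermediateField.mem_bot.1 hfix

theorem frob_apply {K F : Type*} [Field K] [Fintype K] [Field F] [Fintype F] [Algebra K F]
    (s i : ℕ) (x : F) :
    ((FiniteField.frobeniusAlgEquivOfAlgebraic K F ^ s) ^ i) x =
      x ^ Fintype.card K ^ (s * i % Module.finrank K F) := by
  rw [← pow_mul, ← pow_mod_orderOf, FiniteField.orderOf_frobeniusAlgEquivOfAlgebraic,
    AlgEquiv.coe_pow, FiniteField.coe_frobeniusAlgEquivOfAlgebraic_iterate]

/-- Coefficients of a twisted polynomial with top coefficient `t`. -/
def twC {F : Type*} {k : ℕ} (c : Fin k → F) (t : F) : ℕ → F :=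
  fun i => if hi : i < k then c ⟨i, hi⟩ else t

theorem twC_sum {F : Type*} [Field F] {k : ℕ} (c : Fin k → F) (t : F) (n s j : ℕ) :
    (∑ i : Fin k, if j = (s * (i : ℕ)) % n then c i else 0) +
      (if j = (s * k) % n then t else 0) =
    ∑ i ∈ Finset.range (k + 1), if j = (s * i) % n then twC c t i else 0 := by
  rw [Finset.sum_range_succ, Finset.sum_range]
  simp [twC]

theorem twC_at {F : Type*} [Field F] {k : ℕ} (d : ℕ → F) (n s : ℕ) (hs : Nat.gcd s n = 1)
    (hkn : k < n) (i : ℕ) (hi : i ≤ k) :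
    (∑ i' ∈ Finset.range (k + 1), if (s * i) % n = (s * i') % n then d i' else 0) = d i := by
  rw [Finset.sum_eq_single i]
  · simp
  · intro i' hi' hne
    rw [if_neg]
    intro h
    have hi' := Finset.mem_range.1 hi'
    have h2 : i ≡ i' [MOD n] :=
      Nat.ModEq.cancel_left_of_coprime (by rw [Nat.gcd_comm]; exact hs) h
    exact hne (Nat.ModEq.eq_of_lt_of_lt h2 (by omega) (by omega)).symm
  · intro h
    exact absurd (Finset.mem_range.2 (by omega)) h

theorem twL_qeval {K F : Type*} [Field K] [Fintype K] [Field F] [Fintype F] [Algebra K F]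
    (n s k : ℕ) (hn : Module.finrank K F = n) (hn0 : 0 < n) (d : ℕ → F) :
    qeval K (fun j : Fin n => ∑ i ∈ Finset.range (k + 1),
      if (j : ℕ) = (s * i) % n then d i else 0) =
    twL (FiniteField.frobeniusAlgEquivOfAlgebraic K F ^ s) k d := by
  funext x
  rw [twL_apply]
  simp only [qeval, Finset.sum_mul]
  rw [Finset.sum_comm]
  refine Finset.sum_congr rfl fun i _ => ?_
  rw [frob_apply, hn, Finset.sum_eq_single ⟨s * i % n, Nat.mod_lt _ hn0⟩]
  · simp
  · intro j _ hj
    rw [if_neg, zero_mul]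
    intro h
    exact hj (Fin.ext h)
  · simp

end Helper

/-- Sheekey: the generalized twisted Gabidulin code `H_{k,s}(η,h)` with
`N_{q^n/q}(η) ≠ (−1)^{nk}` is an `Fq`-linear MRD code of dimension `nk` with parameters
`(n,n,q;n−k+1)`. -/
theorem twisted_gabidulin_is_MRD
    (Fq F : Type*) [Field Fq] [Fintype Fq] [Field F] [Fintype F] [Algebra Fq F]
    (n s k : ℕ) (h : ℤ) (hn : Module.finrank Fq F = n)
    (hgcd : Nat.gcd s n = 1) (hk1 : 1 ≤ k) (hkn : k ≤ n - 1)
    (η : F) (hnorm : Algebra.norm Fq η ≠ (-1 : Fq) ^ (n * k)) :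
    Nat.card (Hcode Fq n s k h η) = Fintype.card Fq ^ (n * k) ∧
    (∀ a ∈ Hcode Fq n s k h η, a ≠ 0 → n - k + 1 ≤ qrank Fq a) := by
  have hkn' : k < n := by omega
  have hn0 : 0 < n := by omega
  have hk0 : 0 < k := hk1
  have hform : Hcode Fq n s k h η = Set.range (fun c : Fin k → F => fun j : Fin n =>
      ∑ i ∈ Finset.range (k + 1), if (j : ℕ) = (s * i) % n then
        twC c (η * (c ⟨0, hk0⟩) ^ (Fintype.card Fq) ^ (h % (n : ℤ)).toNat) i else 0) := by
    ext a
    simp only [Hcode, Set.mem_ofPred_eq, Set.mem_range, dif_pos hk0, twC_sum]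
    exact ⟨fun ⟨c, hc⟩ => ⟨c, hc.symm⟩, fun ⟨c, hc⟩ => ⟨c, hc.symm⟩⟩
  rw [hform]
  refine ⟨?_, ?_⟩
  · rw [Nat.card_range_of_injective]
    · rw [Nat.card_eq_fintype_card, Fintype.card_fun, Fintype.card_fin,
        Module.card_eq_pow_finrank (K := Fq) (V := F), hn, pow_mul]
    · intro c c' hcc
      funext i
      have := congrFun hcc ⟨s * i % n, Nat.mod_lt _ hn0⟩
      simp only at this
      rw [twC_at _ n s hgcd hkn' i (by omega), twC_at _ n s hgcd hkn' i (by omega)] at this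
      simpa [twC] using this
  · rintro _ ⟨c, rfl⟩ ha
    by_contra hlt
    apply ha
    set t := η * (c ⟨0, hk0⟩) ^ (Fintype.card Fq) ^ (h % (n : ℤ)).toNat with ht
    set σ := FiniteField.frobeniusAlgEquivOfAlgebraic Fq F ^ s with hσ
    have hfix : ∀ x, σ x = x → ∃ y, algebraMap Fq F y = x :=
      fun x hx => frob_fix s (by rw [hn]; exact hgcd) x hx
    simp only [qrank] at hlt
    rw [twL_qeval n s k hn hn0, ← LinearMap.coe_range, Submodule.span_eq] at hlt
    have hrn := LinearMap.finrank_range_add_finrank_ker (twL σ k (twC c t))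
    rw [hn] at hrn
    have hker : k ≤ Module.finrank Fq (LinearMap.ker (twL σ k (twC c t))) := by
      rw [← ht, ← hσ] at hlt
      omega
    have hN := twL_norm σ hfix k _ hker
    have e0 : twC c t 0 = c ⟨0, hk0⟩ := by simp [twC, hk0]
    have ek : twC c t k = t := by simp [twC]
    rw [e0, ek, ht, map_mul, map_pow, FiniteField.pow_card_pow, hn] at hN
    have hc0 : c ⟨0, hk0⟩ = 0 := by
      by_contra hne
      have hne' : Algebra.norm Fq (c ⟨0, hk0⟩) ≠ 0 := Algebra.norm_ne_zero_iff.2 hne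
      apply hnorm
      have h1 : (-1 : Fq) ^ (n * k) * Algebra.norm Fq η = 1 := by
        apply mul_right_cancel₀ hne'
        rw [one_mul, mul_assoc]
        exact hN.symm
      have h2 : (-1 : Fq) ^ (n * k) * (-1 : Fq) ^ (n * k) = 1 := by
        rw [← mul_pow]; simp
      calc Algebra.norm Fq η
          = ((-1 : Fq) ^ (n * k) * (-1 : Fq) ^ (n * k)) * Algebra.norm Fq η := by
            rw [h2, one_mul]
        _ = (-1 : Fq) ^ (n * k) := by rw [mul_assoc, h1, mul_one]
    have ht0 : t = 0 := by
      rw [ht, hc0, zero_pow, mul_zero]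
      exact pow_ne_zero _ Fintype.card_ne_zero
    obtain ⟨m, rfl⟩ : ∃ m, k = m + 1 := ⟨k - 1, by omega⟩
    have hL : twL σ (m + 1) (twC c t) = twL σ m (twC c t) := by
      ext x
      rw [twL_apply, Finset.sum_range_succ, ek, ht0, zero_mul, add_zero, twL_apply]
    rw [hL] at hker
    have hz := twL_zero σ hfix m _ hker
    funext j
    refine Finset.sum_eq_zero fun i hi => ?_
    have hi := Finset.mem_range.1 hi
    have : twC c t i = 0 := by
      rcases Nat.lt_or_ge i (m + 1) with h | h
      · exact hz i (by omega)
      · obtain rfl : i = m + 1 := by omega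
        rw [ek, ht0]
    rw [this, ite_self]
end

section
/- Let H_{k,s}(η,h) be a generalized twisted Gabidulin code with gcd(s,n)=1, 1 ≤ k ≤ n−1, η ∈ F_{q^n}, N_{q^n/q}(η) ≠ (−1)^{nk}. Then its Delsarte dual H_{k,s}(η,h)^⊥ is equivalent to H_{n−k,s}(−η, n−h), and (for η ≠ 0) its adjoint code H_{k,s}(η,h)^⊤ is equivalent to H_{k,s}(1/η, sk−h). -/
section Helpers

variable {Fq : Type*} [Field Fq] [Fintype Fq] {F : Type*} [Field F] [Fintype F] [Algebra Fq F]

/-- The position of the `m`-th `s`-power. -/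
def hpos (n s : ℕ) [NeZero n] (m : ℕ) : Fin n := ⟨(s * m) % n, Nat.mod_lt _ (NeZero.pos n)⟩

lemma hpos_add (n s : ℕ) [NeZero n] (a b : ℕ) : hpos n s (a + b) = hpos n s a + hpos n s b := by
  apply Fin.ext
  simp [hpos, Fin.val_add, mul_add]

lemma hpos_zero (n s : ℕ) [NeZero n] : hpos n s 0 = 0 := by
  apply Fin.ext
  simp [hpos]

lemma hpos_n (n s : ℕ) [NeZero n] : hpos n s n = 0 := by
  apply Fin.ext
  simp [hpos]

lemma hpos_inj {n s : ℕ} (hg : Nat.gcd s n = 1) {a b : ℕ} (ha : a < n) (hb : b < n)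
    (hab : s * a % n = s * b % n) : a = b := by
  have h1 : s * a ≡ s * b [MOD n] := hab
  have h2 : a ≡ b [MOD n] := Nat.ModEq.cancel_left_of_coprime (by rwa [Nat.gcd_comm]) h1
  exact Nat.ModEq.eq_of_lt_of_lt h2 ha hb

lemma hpos_surj {n s : ℕ} [NeZero n] (hg : Nat.gcd s n = 1) (j : Fin n) :
    ∃ m, m < n ∧ j = hpos n s m := by
  have hinj : Function.Injective (fun m : Fin n => hpos n s m) := by
    intro a b hab
    apply Fin.ext
    exact hpos_inj hg a.2 b.2 (congrArg Fin.val hab)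
  obtain ⟨m, hm⟩ := (Finite.injective_iff_surjective.mp hinj) j
  exact ⟨m, m.2, hm.symm⟩

lemma phi_pow (m : ℕ) (x : F) :
    ((FiniteField.frobeniusAlgEquivOfAlgebraic Fq F) ^ m) x = x ^ (Fintype.card Fq) ^ m := by
  induction m generalizing x with
  | zero => simp
  | succ m ih =>
    rw [pow_succ, AlgEquiv.mul_apply, ih]
    simp [FiniteField.coe_frobeniusAlgEquivOfAlgebraic, ← pow_mul, pow_succ, mul_comm]

lemma phi_n {n : ℕ} (hn : Module.finrank Fq F = n) : (FiniteField.frobeniusAlgEquivOfAlgebraic Fq F) ^ n = 1 := by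
  ext x
  rw [phi_pow, ← hn, ← Module.card_eq_pow_finrank, FiniteField.pow_card]
  rfl

lemma phi_mod {n : ℕ} (hn : Module.finrank Fq F = n) (m : ℕ) :
    (FiniteField.frobeniusAlgEquivOfAlgebraic Fq F) ^ (m % n) = (FiniteField.frobeniusAlgEquivOfAlgebraic Fq F) ^ m := by
  conv_rhs => rw [← Nat.mod_add_div m n, pow_add, pow_mul, phi_n hn, one_pow, mul_one]

lemma phi_zmod {n : ℕ} [NeZero n] (hn : Module.finrank Fq F = n) (h : ℤ) :
    (FiniteField.frobeniusAlgEquivOfAlgebraic Fq F) ^ (h % (n : ℤ)).toNat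
      = (FiniteField.frobeniusAlgEquivOfAlgebraic Fq F) ^ h := by
  have h0 : 0 ≤ h % (n : ℤ) := Int.emod_nonneg _ (by exact_mod_cast NeZero.ne n)
  rw [← zpow_natCast, Int.toNat_of_nonneg h0]
  conv_rhs => rw [← Int.emod_add_mul_ediv h n, zpow_add, zpow_mul, zpow_natCast, phi_n hn,
    one_zpow, mul_one]

lemma mem_Hcode {n s k : ℕ} [NeZero n] (hn : Module.finrank Fq F = n) (hg : Nat.gcd s n = 1)
    (hk : 1 ≤ k) (hkn : k < n) (h : ℤ) (η : F) (a : Fin n → F) :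
    a ∈ Hcode Fq n s k h η ↔ (∀ m, k < m → m < n → a (hpos n s m) = 0) ∧
      a (hpos n s k) = η * ((FiniteField.frobeniusAlgEquivOfAlgebraic Fq F) ^ h) (a 0) := by
  have key : ∀ (c : Fin k → F) (m : ℕ), m < n →
      (∑ i : Fin k, if ((hpos n s m : Fin n) : ℕ) = (s * (i : ℕ)) % n then c i else 0) +
      (if hk : 0 < k then
        (if ((hpos n s m : Fin n) : ℕ) = (s * k) % n then
          η * (c ⟨0, hk⟩) ^ (Fintype.card Fq) ^ (h % (n : ℤ)).toNat else 0)
        else 0) = (if hm : m < k then c ⟨m, hm⟩ else 0) +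
        (if m = k then η * ((FiniteField.frobeniusAlgEquivOfAlgebraic Fq F) ^ h) (c ⟨0, hk⟩) else 0) := by
    intro c m hm
    have e1 : ∀ i, i < n → ((((hpos n s m : Fin n) : ℕ) = (s * i) % n) ↔ m = i) := by
      intro i hi
      constructor
      · intro h1
        exact hpos_inj hg hm hi h1
      · rintro rfl; rfl
    rw [dif_pos (show 0 < k from hk), ← phi_pow, phi_zmod hn]
    congr 1
    · have : ∀ i : Fin k, (if ((hpos n s m : Fin n) : ℕ) = (s * (i : ℕ)) % n then c i else 0)
          = if m = (i : ℕ) then c i else 0 := by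
        intro i
        simp only [e1 i (by omega)]
      rw [Finset.sum_congr rfl (fun i _ => this i)]
      split_ifs with hmk
      · rw [Finset.sum_eq_single ⟨m, hmk⟩]
        · simp
        · intro b _ hb
          rw [if_neg]
          rintro rfl
          exact hb rfl
        · simp
      · apply Finset.sum_eq_zero
        intro i _
        rw [if_neg]
        omega
    · simp only [e1 k hkn]
  constructor
  · rintro ⟨c, rfl⟩
    refine ⟨?_, ?_⟩
    · intro m hm hmn
      simp only []
      rw [key c m hmn, dif_neg (by omega), if_neg (by omega), add_zero]
    · rw [← hpos_zero n s]
      simp only []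
      rw [key c k hkn, key c 0 (by omega), dif_neg (by omega), if_pos rfl, dif_pos (by omega),
        if_neg (by omega), add_zero, zero_add]
  · rintro ⟨h1, h2⟩
    refine ⟨fun i => a (hpos n s i), ?_⟩
    funext j
    obtain ⟨m, hm, rfl⟩ := hpos_surj hg j
    rw [key _ m hm]
    simp only [hpos_zero]
    rw [← h2]
    rcases lt_trichotomy m k with hmk | rfl | hmk
    · rw [dif_pos hmk, if_neg (by omega), add_zero]
    · simp
    · rw [dif_neg (by omega), if_neg (by omega), add_zero, h1 m hmk hm]

lemma trace_zero {x : F} (hx : ∀ c : F, Algebra.trace Fq F (x * c) = 0) : x = 0 := by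
  have := traceForm_nondegenerate Fq F
  exact this.1 x (fun c => by simpa [Algebra.traceForm_apply] using hx c)

lemma mem_qperp {n s k : ℕ} [NeZero n] (hn : Module.finrank Fq F = n) (hg : Nat.gcd s n = 1)
    (hk : 1 ≤ k) (hkn : k < n) (h : ℤ) (η : F) (a : Fin n → F) :
    a ∈ qperp Fq (Hcode Fq n s k h η) ↔ (∀ m, 0 < m → m < k → a (hpos n s m) = 0) ∧
      ((FiniteField.frobeniusAlgEquivOfAlgebraic Fq F) ^ h) (a 0) = - η * a (hpos n s k) := by
  have hne : ∀ m m', m < n → m' < n → m ≠ m' → hpos n s m ≠ hpos n s m' := by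
    intro m m' hm hm' hmm h1
    exact hmm (hpos_inj hg hm hm' (congrArg Fin.val h1))
  have h0k : (0 : Fin n) ≠ hpos n s k := by
    rw [← hpos_zero n s]
    exact hne 0 k (by omega) hkn (by omega)
  have tr : ∀ c : F, Algebra.trace Fq F (a 0 * c +
      a (hpos n s k) * (η * ((FiniteField.frobeniusAlgEquivOfAlgebraic Fq F) ^ h) c)) =
      Algebra.trace Fq F ((((FiniteField.frobeniusAlgEquivOfAlgebraic Fq F) ^ h) (a 0) + η * a (hpos n s k))
        * ((FiniteField.frobeniusAlgEquivOfAlgebraic Fq F) ^ h) c) := by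
    intro c
    rw [map_add, ← Algebra.trace_eq_of_algEquiv ((FiniteField.frobeniusAlgEquivOfAlgebraic Fq F) ^ h) (a 0 * c),
      ← map_add, map_mul]
    congr 1
    ring
  constructor
  · intro ha
    refine ⟨?_, ?_⟩
    · intro m hm0 hmk
      apply trace_zero (Fq := Fq)
      intro c
      have := ha (Pi.single (hpos n s m) c) (by
        rw [mem_Hcode hn hg hk hkn]
        refine ⟨fun m' h1 h2 => ?_, ?_⟩
        · rw [Pi.single_eq_of_ne (hne _ _ h2 (by omega) (by omega))]
        · rw [Pi.single_eq_of_ne (hne _ _ hkn (by omega) (by omega)), ← hpos_zero n s,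
            Pi.single_eq_of_ne (hne _ _ (by omega) (by omega) (by omega))]
          simp)
      rw [Finset.sum_eq_single (hpos n s m)] at this
      · simpa using this
      · intro b _ hb
        rw [Pi.single_eq_of_ne hb, mul_zero]
      · simp
    · have : ((FiniteField.frobeniusAlgEquivOfAlgebraic Fq F) ^ h) (a 0) + η * a (hpos n s k) = 0 := by
        apply trace_zero (Fq := Fq)
        intro d
        obtain ⟨c, rfl⟩ := ((FiniteField.frobeniusAlgEquivOfAlgebraic Fq F) ^ h).surjective d
        rw [← tr c]
        have := ha (fun i => if i = 0 then c else if i = hpos n s k then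
          (η * ((FiniteField.frobeniusAlgEquivOfAlgebraic Fq F) ^ h) c) else 0) (by
          rw [mem_Hcode hn hg hk hkn]
          refine ⟨fun m' h1 h2 => ?_, ?_⟩
          · rw [if_neg, if_neg (hne _ _ h2 (by omega) (by omega))]
            rw [← hpos_zero n s]
            exact hne _ _ h2 (by omega) (by omega)
          · rw [if_neg h0k.symm, if_pos rfl, if_pos rfl])
        rw [Fintype.sum_eq_add 0 (hpos n s k) h0k] at this
        · simpa [h0k.symm] using this
        · rintro x ⟨h1, h2⟩
          simp [h1, h2]
      linear_combination this
  · rintro ⟨h1, h2⟩ b hb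
    rw [mem_Hcode hn hg hk hkn] at hb
    rw [Fintype.sum_eq_add 0 (hpos n s k) h0k, hb.2, tr, h2]
    · simp
    · rintro x ⟨hx1, hx2⟩
      obtain ⟨m, hm, rfl⟩ := hpos_surj hg x
      rcases lt_trichotomy m k with hmk | rfl | hmk
      · rw [h1 m _ hmk, zero_mul]
        rcases Nat.eq_zero_or_pos m with rfl | h3
        · exact absurd (hpos_zero n s) hx1
        · exact h3
      · exact absurd rfl hx2
      · rw [hb.1 m hmk hm, mul_zero]

lemma qeval_single {n : ℕ} (t : Fin n) :
    Function.Bijective (qeval Fq (fun j : Fin n => if j = t then (1 : F) else 0)) := by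
  have : qeval Fq (fun j : Fin n => if j = t then (1 : F) else 0) =
      ((FiniteField.frobeniusAlgEquivOfAlgebraic Fq F) ^ (t : ℕ) : F ≃ₐ[Fq] F) := by
    funext x
    rw [phi_pow]
    simp [qeval]
  rw [this]
  exact AlgEquiv.bijective _

lemma qcomp_one_left {n : ℕ} [NeZero n] (a : Fin n → F) :
    qcomp Fq (fun j : Fin n => if j = 0 then (1 : F) else 0) a = a := by
  funext j
  simp [qcomp]

lemma qcomp_single_right {n : ℕ} [NeZero n] (t : Fin n) (a : Fin n → F) :
    qcomp Fq a (fun j : Fin n => if j = t then (1 : F) else 0) = fun j => a (j - t) := by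
  funext j
  simp only [qcomp]
  rw [Finset.sum_eq_single (j - t)]
  · simp
  · intro b _ hb
    rw [if_neg, zero_pow (by positivity), mul_zero]
    intro h1
    apply hb
    rw [← h1]
    abel
  · simp

lemma codeEquiv_of {n : ℕ} [NeZero n] (C C' : Set (Fin n → F)) (t : Fin n) (σ : F ≃ₐ[Fq] F)
    (H : ∀ a, a ∈ C ↔ (fun j => σ (a (j - t))) ∈ C') : CodeEquiv Fq C C' := by
  refine ⟨fun j => if j = 0 then 1 else 0, fun j => if j = t then 1 else 0, σ.toRingEquiv,
    qeval_single 0, qeval_single t, ?_⟩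
  ext f
  simp only [qcomp_one_left, qcomp_single_right, Set.mem_image]
  constructor
  · intro hf
    have e : (fun j => σ ((fun i => σ.symm (f (i + t))) (j - t))) = f := by
      funext j
      simp
    refine ⟨fun i => σ.symm (f (i + t)), ?_, e⟩
    rw [H, e]
    exact hf
  · rintro ⟨a, ha, rfl⟩
    exact (H a).1 ha

lemma qadjoint_eq {n : ℕ} [NeZero n] (a : Fin n → F) (j : Fin n) :
    qadjoint Fq a j = ((FiniteField.frobeniusAlgEquivOfAlgebraic Fq F) ^ (j : ℕ)) (a (-j)) := by
  rw [phi_pow, qadjoint]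
  congr 2

lemma qadjoint_qadjoint {n : ℕ} [NeZero n] (hn : Module.finrank Fq F = n) (a : Fin n → F) :
    qadjoint Fq (qadjoint Fq a) = a := by
  funext j
  rw [qadjoint_eq, qadjoint_eq, ← AlgEquiv.mul_apply, ← pow_add, neg_neg, ← phi_mod hn]
  have : ((j : ℕ) + ((-j : Fin n) : ℕ)) % n = 0 := by
    rw [← Fin.val_add]
    simp
  rw [this]
  simp

end Helpers

/-- Sheekey; Lunardon–Trombetti–Zhou: the Delsarte dual of
`H_{k,s}(η,h)` is equivalent to `H_{n−k,s}(−η, n−h)` and, for `η ≠ 0`, its adjoint code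
is equivalent to `H_{k,s}(1/η, sk−h)`. -/
theorem twisted_gabidulin_dual_and_adjoint
    (Fq F : Type*) [Field Fq] [Fintype Fq] [Field F] [Fintype F] [Algebra Fq F]
    (n s k : ℕ) (h : ℤ) (hn : Module.finrank Fq F = n)
    (hgcd : Nat.gcd s n = 1) (hk1 : 1 ≤ k) (hkn : k ≤ n - 1)
    (η : F) (hnorm : Algebra.norm Fq η ≠ (-1 : Fq) ^ (n * k)) :
    CodeEquiv Fq (qperp Fq (Hcode Fq n s k h η))
      (Hcode Fq n s (n - k) ((n : ℤ) - h) (-η)) ∧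
    (η ≠ 0 → CodeEquiv Fq (qadjoint Fq '' Hcode Fq n s k h η)
      (Hcode Fq n s k ((s : ℤ) * (k : ℤ) - h) η⁻¹)) := by
  have hkn' : k < n := by omega
  haveI : NeZero n := ⟨by omega⟩
  constructor
  · apply codeEquiv_of _ _ (hpos n s (n - k)) ((FiniteField.frobeniusAlgEquivOfAlgebraic Fq F) ^ h)
    intro a
    rw [mem_qperp hn hgcd hk1 hkn', mem_Hcode hn hgcd (by omega) (by omega)]
    have hz : (0 : Fin n) - hpos n s (n - k) = hpos n s k := by
      rw [sub_eq_iff_eq_add, ← hpos_add, show k + (n - k) = n by omega, hpos_n]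
    have hm : ∀ m, hpos n s (m + (n - k)) - hpos n s (n - k) = hpos n s m := by
      intro m
      rw [hpos_add, add_sub_cancel_right]
    have hfr : ((FiniteField.frobeniusAlgEquivOfAlgebraic Fq F) ^ ((n : ℤ) - h))
        (((FiniteField.frobeniusAlgEquivOfAlgebraic Fq F) ^ h) (a (hpos n s k))) = a (hpos n s k) := by
      rw [← AlgEquiv.mul_apply, ← zpow_add, sub_add_cancel, zpow_natCast, phi_n hn]
      rfl
    rw [hz, hfr, sub_self]
    apply and_congr _ Iff.rfl
    simp only [EmbeddingLike.map_eq_zero_iff]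
    constructor
    · intro H m h1 h2
      obtain ⟨d, rfl⟩ : ∃ d, m = d + (n - k) := ⟨m - (n - k), by omega⟩
      rw [hm]
      exact H d (by omega) (by omega)
    · intro H m h1 h2
      rw [← hm]
      exact H _ (by omega) (by omega)
  · intro hη
    apply codeEquiv_of _ _ (hpos n s k) ((FiniteField.frobeniusAlgEquivOfAlgebraic Fq F) ^ h)
    intro a
    have himg : a ∈ qadjoint Fq '' Hcode Fq n s k h η ↔ qadjoint Fq a ∈ Hcode Fq n s k h η := by
      constructor
      · rintro ⟨b, hb, rfl⟩
        rwa [qadjoint_qadjoint hn]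
      · intro hb
        exact ⟨_, hb, qadjoint_qadjoint hn a⟩
    rw [himg, mem_Hcode hn hgcd hk1 hkn', mem_Hcode hn hgcd hk1 hkn']
    simp only [qadjoint_eq, EmbeddingLike.map_eq_zero_iff]
    have hfr : ((FiniteField.frobeniusAlgEquivOfAlgebraic Fq F) ^ ((s : ℤ) * k - h))
        (((FiniteField.frobeniusAlgEquivOfAlgebraic Fq F) ^ h) (a (0 - hpos n s k))) =
        ((FiniteField.frobeniusAlgEquivOfAlgebraic Fq F) ^ ((hpos n s k : Fin n) : ℕ)) (a (-hpos n s k)) := by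
      rw [← AlgEquiv.mul_apply, ← zpow_add, sub_add_cancel, zero_sub]
      have : (FiniteField.frobeniusAlgEquivOfAlgebraic Fq F) ^ ((hpos n s k : Fin n) : ℕ) =
        (FiniteField.frobeniusAlgEquivOfAlgebraic Fq F) ^ (s * k) := phi_mod hn _
      rw [this]
      norm_cast
    rw [hfr, sub_self]
    apply and_congr
    · have hm : ∀ m, k < m → m < n → hpos n s m - hpos n s k = - hpos n s (n + k - m) := by
        intro m h1 h2
        rw [sub_eq_iff_eq_add, eq_neg_add_iff_add_eq, ← hpos_add,
          show n + k - m + m = n + k by omega, hpos_add, hpos_n, zero_add]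
      constructor
      · intro H m h1 h2
        rw [hm m h1 h2]
        exact H _ (by omega) (by omega)
      · intro H m h1 h2
        have := H (n + k - m) (by omega) (by omega)
        rw [hm _ (by omega) (by omega), show n + k - (n + k - m) = m by omega] at this
        exact this
    · rw [eq_inv_mul_iff_mul_eq₀ hη]
      simp only [Fin.val_zero, pow_zero, neg_zero]
      exact eq_comm
end

section
/- For every prime power q > 4 there exists δ ∈ F_{q^2} ⊆ F_{q^6} such that C₁ = ⟨x, δx^q + x^{q^4}⟩_{F_{q^6}} is an F_q-linear MRD code with parameters (6,6,q;5); equivalently, every nonzero q-polynomial of the form α x + β(δ x^q + x^{q^4}) with α, β ∈ F_{q^6} has rank at least 5 as an F_q-linear map of F_{q^6}. -/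
theorem core_alg {K : Type*} [Field K] (z0 z1 z2 z3 z4 z5 d y : K)
   (h03 : z0 ≠ z3) (h13 : z1 ≠ z3) (h23 : z2 ≠ z3) (h43 : z4 ≠ z3) (h53 : z5 ≠ z3)
   (h01 : z0 ≠ z1) (_h04 : z0 ≠ z4) (_h21 : z2 ≠ z1) (_h05 : z0 ≠ z5)
   (hd0 : d ≠ 0) (hd1 : d ≠ 1) (hd3 : d + 3 ≠ 0)
   (E0 : (z4-z0)*(z1-z3) = d*((z1-z0)*(z4-z3)))
   (E1 : (z5-z1)*(z2-z4) = d*((z2-z1)*(z5-z4)))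
   (E2 : (z0-z2)*(z3-z5) = d*((z3-z2)*(z0-z5)))
   (hy : (z5-z0)*(z1-z3) = y*((z5-z3)*(z1-z0)))
   (hs : y*y - (d+1)*y+1 = 0 → (z0-z1)*(z2-z4) = y*((z0-z4)*(z2-z1))) : False := by
  have a0 := sub_ne_zero.2 h03
  have a1 := sub_ne_zero.2 h13
  have a2 := sub_ne_zero.2 h23
  have a4 := sub_ne_zero.2 h43
  have a5 := sub_ne_zero.2 h53
  have a10 := sub_ne_zero.2 h01.symm
  obtain ⟨b, hb⟩ : ∃ b, (z2-z0)*(z1-z3) = b*((z2-z3)*(z1-z0)) :=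
    ⟨(z2-z0)*(z1-z3)/((z2-z3)*(z1-z0)), by field_simp⟩
  have key : ∀ x x' c c' : K, (x-z0)*(z1-z3) = c*((x-z3)*(z1-z0)) →
      (x'-z0)*(z1-z3) = c'*((x'-z3)*(z1-z0)) →
      (x-x')*((z0-z3)*(z1-z3)) = (c - c')*((x-z3)*(x'-z3)*(z1-z0)) * (-1) * (-1) := by
    intro x x' c c' h h'
    linear_combination (x'-z3)*h - (x-z3)*h'
  have k1 : (z1-z0)*(z1-z3) = 1*((z1-z3)*(z1-z0)) := by ring
  have F2 : b = d*y := by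
    have hh : (b - d*y)*((z2-z3)*(z5-z3)*(z1-z0)) = 0 := by
      linear_combination (-(z5-z3))*hb + d*(z2-z3)*hy + (z1-z3)*E2
    have : (z2-z3)*(z5-z3)*(z1-z0) ≠ 0 := by positivity
    exact sub_eq_zero.1 ((mul_eq_zero.1 hh).resolve_right this)
  have E0' : (z4-z0)*(z1-z3) = d*((z4-z3)*(z1-z0)) := by linear_combination E0
  have p51 := key _ _ _ _ hy k1
  have p24 := key _ _ _ _ hb E0'
  have p21 := key _ _ _ _ hb k1
  have p54 := key _ _ _ _ hy E0'
  have p04 := key z0 z4 0 d (by ring) E0'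
  have p01 := key z0 z1 0 1 (by ring) k1
  have hA : (z0-z3)*(z1-z3) ≠ 0 := mul_ne_zero a0 a1
  have F1 : (y-1)*(b-d) = d*((b-1)*(y-d)) := by
    have hh : ((y-1)*(b-d) - d*((b-1)*(y-d)))*((z1-z0)^2*(z5-z3)*(z1-z3)*(z2-z3)*(z4-z3)) = 0 := by
      have := congrArg (fun t => t * ((z0-z3)*(z1-z3))^2) E1
      linear_combination this - (z2-z4)*((z0-z3)*(z1-z3))*p51 - (y-1)*((z5-z3)*(z1-z3)*(z1-z0))*p24 + d*((z5-z4)*((z0-z3)*(z1-z3)))*p21+d*(b-1)*((z2-z3)*(z1-z3)*(z1-z0))*p54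
    have : (z1-z0)^2*(z5-z3)*(z1-z3)*(z2-z3)*(z4-z3) ≠ 0 := by positivity
    exact sub_eq_zero.1 ((mul_eq_zero.1 hh).resolve_right this)
  have hyq : y*y - (d+1)*y+1 = 0 := by
    have hh : (y*y - (d+1)*y+1) * (d*(1-d)) = 0 := by subst F2; linear_combination F1
    exact (mul_eq_zero.1 hh).resolve_right (mul_ne_zero hd0 (sub_ne_zero.2 hd1.symm))
  have E3 := hs hyq
  have F3 : (-1)*(b-d) = y*((-d)*(b-1)) := by
    have hh : ((-1)*(b-d) - y*((-d)*(b-1)))*((z1-z0)^2*(z0-z3)*(z1-z3)*(z2-z3)*(z4-z3)) = 0 := by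
      have := congrArg (fun t => t * ((z0-z3)*(z1-z3))^2) E3
      linear_combination this - (z2-z4)*((z0-z3)*(z1-z3))*p01 - (-1)*((z0-z3)*(z1-z3)*(z1-z0))*p24 + y*((z0-z4)*((z0-z3)*(z1-z3)))*p21+y*(b-1)*((z2-z3)*(z1-z3)*(z1-z0))*p04
    have : (z1-z0)^2*(z0-z3)*(z1-z3)*(z2-z3)*(z4-z3) ≠ 0 := by positivity
    exact sub_eq_zero.1 ((mul_eq_zero.1 hh).resolve_right this)
  have F4 : d*y*y - 2*y + 1 = 0 := by
    have hh : d*(d*y*y - 2*y + 1) = 0 := by subst F2; linear_combination F3 * (-1) * (-1)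
    exact (mul_eq_zero.1 hh).resolve_left hd0
  have F5 : (d+2)*y - 1 = 0 := by
    have hh : (d-1)*((d+2)*y - 1) = 0 := by linear_combination F4 - d*hyq
    exact (mul_eq_zero.1 hh).resolve_left (sub_ne_zero.2 hd1)
  apply hd3
  linear_combination (d+2)^2*hyq - ((d+2)*y+1 - (d+1)*(d+2))*F5

theorem mem_base_of_pow (Fq F : Type*) [Field Fq] [Fintype Fq] [Field F] [Algebra Fq F]
    (z : F) (hz : z ^ Fintype.card Fq = z) : ∃ c : Fq, algebraMap Fq F c = z := by
  classical
  by_contra! h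
  let S : Finset F := insert z (Finset.univ.image (algebraMap Fq F))
  have hS : S.card = Fintype.card Fq + 1 := by
    rw [Finset.card_insert_of_notMem (by simpa using h),
      Finset.card_image_of_injective _ (algebraMap Fq F).injective, Finset.card_univ]
  have hq : 1 < Fintype.card Fq := Fintype.one_lt_card
  have hne := FiniteField.X_pow_card_sub_X_ne_zero F hq
  have hle := Polynomial.card_le_degree_of_subset_roots (p := (Polynomial.X ^ Fintype.card Fq - Polynomial.X : Polynomial F)) (Z := S) (by
    intro x hx
    have hx' : x ∈ S := hx
    rw [Polynomial.mem_roots hne]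
    simp only [S, Finset.mem_insert, Finset.mem_image, Finset.mem_univ, true_and] at hx'
    rcases hx' with rfl | ⟨c, rfl⟩
    · simp [hz]
    · simp [← map_pow, FiniteField.pow_card])
  rw [FiniteField.X_pow_card_sub_X_natDegree_eq F hq] at hle
  omega

theorem exists_delta (F : Type*) [Field F] [Fintype F] (q : ℕ) (hq : 1 < q)
    (hF : Fintype.card F = q ^ 6) (d : F) (hd0 : d ≠ 0) (hd : d ^ q = d) :
    ∃ δ : F, δ ^ q ^ 2 = δ ∧ δ ^ q * δ = d := by
  classical
  obtain ⟨g, hg⟩ := IsCyclic.exists_generator (α := Fˣ)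
  obtain ⟨p, rfl⟩ : ∃ p, q = p + 1 := ⟨q - 1, by omega⟩
  have hp : 0 < p := by omega
  have ho : orderOf g = p * ((p+2) * ((p+1)^4 + (p+1)^2+1)) := by
    rw [orderOf_eq_card_of_forall_mem_zpowers hg, Nat.card_eq_fintype_card, Fintype.card_units, hF]
    have : (p+1)^6 = p * ((p+2) * ((p+1)^4 + (p+1)^2+1)) + 1 := by ring
    omega
  obtain ⟨k, hk⟩ := (Submonoid.mem_powers_iff _ _).1 (mem_powers_iff_mem_zpowers.2 (hg (Units.mk0 d hd0)))
  have h1 : g ^ (k * p) = 1 := by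
    rw [pow_mul, hk]
    ext
    push_cast
    have : d ^ p * d = 1 * d := by rw [← pow_succ, hd, one_mul]
    simpa using mul_right_cancel₀ hd0 this
  have h2 := orderOf_dvd_of_pow_eq_one h1
  rw [ho, mul_comm k p] at h2
  obtain ⟨j, rfl⟩ := Nat.dvd_of_mul_dvd_mul_left hp h2
  have hgo : g ^ (p * ((p+2) * ((p+1)^4 + (p+1)^2+1))) = 1 := by rw [← ho]; exact pow_orderOf_eq_one g
  set M := (p+1)^4 + (p+1)^2+1
  refine ⟨((g ^ (M * j) : Fˣ) : F), ?_, ?_⟩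
  · have : (g ^ (M * j)) ^ (p+1)^2 = g ^ (M * j) := by
      rw [← pow_mul, show M * j * (p+1)^2 = (p * ((p+2) * M)) * j + M * j by ring, pow_add, pow_mul, hgo]
      simp
    exact_mod_cast congrArg Units.val this
  · have : (g ^ (M * j)) ^ (p+1) * g ^ (M * j) = Units.mk0 d hd0 := by
      rw [← hk, ← pow_mul, ← pow_add]; congr 1; ring
    have := congrArg Units.val this
    push_cast at this
    simpa using this

theorem exists_y (K : Type*) [Field K] [Fintype K] (hq : 4 < Fintype.card K) :
    ∃ y : K, y ≠ 0 ∧ y - 1 ≠ 0 ∧ y + 1 ≠ 0 ∧ y * y - y + 1 ≠ 0 := by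
  by_cases h5 : (5 : K) = 0
  · refine ⟨2, fun h => ?_, fun h => ?_, fun h => ?_, fun h => ?_⟩ <;>
      apply one_ne_zero (α := K)
    · linear_combination h5 - 2 * h
    · linear_combination h
    · linear_combination 2 * h - h5
    · linear_combination 2 * h - h5
  · have hc : Fintype.card K ≠ 5 := by
      intro h
      apply h5
      have := Nat.cast_card_eq_zero K
      rw [h] at this
      exact_mod_cast this
    let p : Polynomial K := Polynomial.X * (Polynomial.X - 1) * (Polynomial.X + 1) *
      (Polynomial.X * Polynomial.X - Polynomial.X + 1)
    have hpm : p.natDegree = 5 := by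
      simp only [p]; compute_degree!
    have hp0 : p ≠ 0 := by
      intro h; rw [h] at hpm; simp at hpm
    obtain ⟨y, hy⟩ := Polynomial.exists_eval_ne_zero_of_natDegree_lt_card p hp0
      (by rw [hpm, Cardinal.mk_fintype]; exact_mod_cast (by omega : 5 < Fintype.card K))
    refine ⟨y, ?_⟩
    simp only [p, Polynomial.eval_mul, Polynomial.eval_sub, Polynomial.eval_add, Polynomial.eval_X,
      Polynomial.eval_one, mul_ne_zero_iff] at hy
    tauto

theorem no_z (F : Type*) [Field F] (σ : F →+* F) (h6 : ∀ x, σ (σ (σ (σ (σ (σ x))))) = x)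
    (y δ d v z : F) (hy : σ y = y) (hy0 : y ≠ 0) (hy1 : y - 1 ≠ 0) (hy2 : y + 1 ≠ 0)
    (hy3 : y * y - y + 1 ≠ 0) (hd : d * y = y * y - y + 1) (hδ : σ (σ δ) = δ)
    (hδd : σ δ * δ = d) (hv : v ≠ 0)
    (hz : δ * σ v * (σ z - z) + σ (σ (σ (σ v))) * (σ (σ (σ (σ z))) - z) = 0) : σ z = z := by
  have hinj := σ.injective
  have hσd : σ d = d := by rw [← hδd, map_mul, hδ, mul_comm]
  have hd0 : d ≠ 0 := by rintro rfl; apply hy3; rw [← hd, zero_mul]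
  have hd1 : d ≠ 1 := by
    rintro rfl; apply hy1
    have : (y-1)^2 = 0 := by linear_combination -hd
    exact pow_eq_zero_iff (two_ne_zero) |>.1 this
  have hd3 : d + 3 ≠ 0 := by
    intro h; apply hy2
    have : (y+1)^2 = 0 := by linear_combination -hd + y*h
    exact pow_eq_zero_iff (two_ne_zero) |>.1 this
  by_contra h10
  obtain ⟨z1, h1⟩ : ∃ a, a = σ z := ⟨_, rfl⟩
  obtain ⟨z2, h2⟩ : ∃ a, a = σ z1 := ⟨_, rfl⟩
  obtain ⟨z3, h3⟩ : ∃ a, a = σ z2 := ⟨_, rfl⟩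
  obtain ⟨z4, h4⟩ : ∃ a, a = σ z3 := ⟨_, rfl⟩
  obtain ⟨z5, h5⟩ : ∃ a, a = σ z4 := ⟨_, rfl⟩
  have h0 : σ z5 = z := by rw [h5, h4, h3, h2, h1]; exact h6 z
  have hz' := congrArg (fun x => σ (σ (σ x))) hz
  simp only [map_add, map_mul, map_sub, map_zero, h6, hδ, ← h1, ← h2, ← h3, ← h4, ← h5, h0] at hz hz'
  have hv1 : σ v ≠ 0 := (map_ne_zero σ).2 hv
  have hv4 : σ (σ (σ (σ v))) ≠ 0 := by simpa using hv
  have E0 : (z4-z)*(z1-z3) = d*((z1-z)*(z4-z3)) := by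
    apply mul_left_cancel₀ (mul_ne_zero hv1 hv4)
    linear_combination (σ v * (z1 - z3)) * hz - (σ v * δ * (z1 - z)) * hz' + (σ v * (σ (σ (σ (σ v)))) * (z1-z)*(z4-z3)) * hδd
  have E1 := congrArg σ E0
  simp only [map_mul, map_sub, hσd, ← h1, ← h2, ← h3, ← h4, ← h5, h0] at E1
  have E2 := congrArg σ E1
  simp only [map_mul, map_sub, hσd, ← h1, ← h2, ← h3, ← h4, ← h5, h0] at E2
  rw [← h1] at h10
  have n4 : z4 ≠ z := by
    intro h
    rw [h, sub_self, zero_mul] at E0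
    have := (mul_eq_zero.1 E0.symm).resolve_left hd0
    rcases mul_eq_zero.1 this with h' | h'
    · exact h10 (sub_eq_zero.1 h')
    · apply h10
      apply hinj; apply hinj; apply hinj
      rw [← h1, ← h2, ← h3, ← h4]
      exact h.trans (sub_eq_zero.1 h')
  have n3 : z3 ≠ z := by
    intro h
    have h41 : z4 = z1 := by rw [h4, h, ← h1]
    rw [h, h41] at E0
    have hh : (1 - d) * (z1 - z)^2 = 0 := by linear_combination E0
    have := (mul_eq_zero.1 hh).resolve_left (sub_ne_zero.2 hd1.symm)
    exact h10 (sub_eq_zero.1 (pow_eq_zero_iff (two_ne_zero) |>.1 this))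
  have n2 : z2 ≠ z := by
    intro h
    apply n4
    rw [h4, h3, h, ← h1, ← h2, h]
  have n5 : z5 ≠ z := by
    intro h
    apply h10; rw [h1, ← h, h0, h]
  have n21 : z2 ≠ z1 := by rw [h2]; nth_rw 2 [h1]; exact hinj.ne h10
  have n32 : z3 ≠ z2 := by rw [h3]; nth_rw 2 [h2]; exact hinj.ne n21
  have n43 : z4 ≠ z3 := by rw [h4]; nth_rw 2 [h3]; exact hinj.ne n32
  have n31 : z3 ≠ z1 := by rw [h3, h1]; exact hinj.ne n2
  have n53 : z5 ≠ z3 := by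
    rw [h5, h3]; apply hinj.ne; rw [h4, h2]; exact hinj.ne n31
  have a5 := sub_ne_zero.2 n53
  have a1 := sub_ne_zero.2 h10
  obtain ⟨Y, hY⟩ : ∃ Y, Y = (z5-z)*(z1-z3)/((z5-z3)*(z1-z)) := ⟨_, rfl⟩
  have hY' : (z5-z)*(z1-z3) = Y*((z5-z3)*(z1-z)) := by rw [hY]; field_simp
  refine core_alg z z1 z2 z3 z4 z5 d Y n3.symm n31.symm n32.symm n43 n53 (Ne.symm h10) n4.symm n21 n5.symm
    hd0 hd1 hd3 E0 E1 E2 hY' ?_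
  intro hYq
  have hσY : σ Y = Y := by
    have : (Y - y) * (y * Y - 1) = 0 := by linear_combination y * hYq + Y * hd
    rcases mul_eq_zero.1 this with h | h
    · rw [sub_eq_zero.1 h, hy]
    · have : Y = y⁻¹ := by field_simp; linear_combination h
      rw [this, map_inv₀, hy]
  have := congrArg σ hY'
  simpa only [map_mul, map_sub, hσY, ← h1, ← h2, ← h3, ← h4, ← h5, h0] using this

/-- Csajbók–Marino–Polverino–Zanella: for `q > 4` there is
`δ ∈ F_{q²} ⊆ F_{q⁶}` such that `C₁ = ⟨x, δx^q + x^{q⁴}⟩_{F_{q⁶}}` is an MRD code with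
parameters `(6,6,q;5)`: every nonzero `αx + β(δx^q + x^{q⁴})` has rank at least `5`. -/
theorem CMPZ_code_six
    (Fq F : Type*) [Field Fq] [Fintype Fq] [Field F] [Fintype F] [Algebra Fq F]
    (hn : Module.finrank Fq F = 6) (hq : 4 < Fintype.card Fq) :
    ∃ δ : F, δ ^ (Fintype.card Fq) ^ 2 = δ ∧
      ∀ α β : F, ¬(α = 0 ∧ β = 0) →
        5 ≤ qrank Fq (fun j : Fin 6 =>
          if (j : ℕ) = 0 then α else
          if (j : ℕ) = 1 then β * δ else
          if (j : ℕ) = 4 then β else 0) := by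
  classical
  set q := Fintype.card Fq with hqdef
  have hFc : Fintype.card F = q ^ 6 := by rw [Module.card_eq_pow_finrank (K := Fq) (V := F), hn]
  obtain ⟨y, hy0, hy1, hy2, hy3⟩ := exists_y Fq hq
  let σ : F →ₐ[Fq] F := FiniteField.frobeniusAlgHom Fq F
  have hσ : ∀ x, σ x = x ^ q := fun x => rfl
  have inj := (algebraMap Fq F).injective
  have hd0 : (algebraMap Fq F ((y * y - y + 1) / y)) ≠ 0 :=
    (map_ne_zero _).2 (div_ne_zero hy3 hy0)
  obtain ⟨δ, hδ1, hδ2⟩ := exists_delta F q (by omega) hFc (algebraMap Fq F ((y * y - y + 1) / y)) hd0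
    (by rw [← map_pow, FiniteField.pow_card])
  refine ⟨δ, hδ1, ?_⟩
  intro α β hαβ
  have h6 : ∀ x, σ (σ (σ (σ (σ (σ x))))) = x := by
    intro x
    simp only [hσ, ← pow_mul]
    rw [show q * q * q * q * q * q = q ^ 6 by ring, ← hFc, FiniteField.pow_card]
  let L : F →ₗ[Fq] F := α • LinearMap.id + (β * δ) • σ.toLinearMap
    + β • (σ.toLinearMap ∘ₗ σ.toLinearMap ∘ₗ σ.toLinearMap ∘ₗ σ.toLinearMap)
  have hL : ∀ x, L x = α * x + β * δ * σ x + β * σ (σ (σ (σ x))) := by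
    intro x; simp [L]
  have hLe : qeval Fq (fun j : Fin 6 =>
          if (j : ℕ) = 0 then α else
          if (j : ℕ) = 1 then β * δ else
          if (j : ℕ) = 4 then β else 0) = L := by
    funext x
    rw [hL]
    simp only [hσ, ← pow_mul, qeval, Fin.sum_univ_six, ← hqdef]
    norm_num
    left
    congr 1
    ring
  have hrk : qrank Fq (fun j : Fin 6 =>
          if (j : ℕ) = 0 then α else
          if (j : ℕ) = 1 then β * δ else
          if (j : ℕ) = 4 then β else 0) = Module.finrank Fq (LinearMap.range L) := by
    unfold qrank
    rw [hLe, ← LinearMap.coe_range, Submodule.span_eq]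
  rw [hrk]
  have hfd : FiniteDimensional Fq F := Module.finite_of_finrank_pos (by omega)
  have hrn := LinearMap.finrank_range_add_finrank_ker L
  suffices h : Module.finrank Fq (LinearMap.ker L) ≤ 1 by omega
  by_cases hbot : ∃ v ∈ LinearMap.ker L, v ≠ 0
  swap
  · push Not at hbot
    rw [(Submodule.eq_bot_iff _).2 hbot]
    simp
  obtain ⟨v, hvk, hv⟩ := hbot
  refine finrank_le_one (⟨v, hvk⟩ : LinearMap.ker L) ?_
  rintro ⟨w, hwk⟩
  rw [LinearMap.mem_ker, hL] at hvk hwk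
  have hβ : β ≠ 0 := by
    rintro rfl
    apply hαβ
    refine ⟨?_, rfl⟩
    simpa [hv] using hvk
  obtain ⟨z, rfl⟩ : ∃ z, w = z * v := ⟨w / v, by field_simp⟩
  have hzz : σ z = z := by
    refine no_z F σ.toRingHom h6 (algebraMap Fq F y) δ _ v z (σ.commutes y) ((map_ne_zero _).2 hy0)
      ?_ ?_ ?_ ?_ ?_ hδ2 hv ?_
    · rw [← map_one (algebraMap Fq F), ← map_sub]; exact (map_ne_zero _).2 hy1
    · rw [← map_one (algebraMap Fq F), ← map_add]; exact (map_ne_zero _).2 hy2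
    · rw [← map_one (algebraMap Fq F), ← map_mul, ← map_sub, ← map_add]; exact (map_ne_zero _).2 hy3
    · rw [← map_one (algebraMap Fq F), ← map_mul, ← map_mul, ← map_sub, ← map_add]
      congr 1; field_simp
    · change σ (σ δ) = δ
      rw [hσ, hσ, ← pow_mul, ← sq, hδ1]
    · change δ * σ v * (σ z - z) + σ (σ (σ (σ v))) * (σ (σ (σ (σ z))) - z) = 0
      simp only [map_mul] at hwk
      apply (mul_eq_zero.1 _).resolve_left hβ
      linear_combination hwk - z * hvk
  obtain ⟨c, hc⟩ := mem_base_of_pow Fq F z hzz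
  refine ⟨c, ?_⟩
  ext
  simp [Algebra.smul_def, hc]
end
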